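/- Let q and q′ be nondegenerate quadratic forms of rank 4 over a field k of characteristic ≠ 2. Then k(q) and k(q′) are isomorphic as k-algebras if and only if for every field extension l/k of degree at most 2, the Brauer kernels coincide: κ(l(q_l)/l) = κ(l(q′_l)/l) as subgroups of Br(l). -/

import Mathlib

open scoped TensorProduct
open Quaternion
set_option synthInstance.maxHeartbeats 1000000
set_option maxHeartbeats 1000000
noncomputable section

universe u v

/-- Upper-triangular coefficient matrix of a quadratic form on `Fin n → R`. -/
def coeffMatrix {R : Type*} [CommRing R] {n : ℕ} (q : QuadraticForm R (Fin n → R)) :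
    Matrix (Fin n) (Fin n) R :=
  Matrix.of fun i j =>
    if i = j then q (Pi.single i 1)
    else if i < j then QuadraticMap.polar q (Pi.single i 1) (Pi.single j 1)
    else 0

/-- Base change of a quadratic form on `Fin n → R` along `R → l`. -/
def extendQF {R : Type*} [CommRing R] {n : ℕ} (q : QuadraticForm R (Fin n → R))
    (l : Type*) [CommRing l] [Algebra R l] : QuadraticForm l (Fin n → l) :=
  ((coeffMatrix q).map (algebraMap R l)).toQuadraticMap'

/-- Gram matrix of the polar bilinear form of `q`. -/
def polarMatrix {R : Type*} [CommRing R] {n : ℕ} (q : QuadraticForm R (Fin n → R)) :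
    Matrix (Fin n) (Fin n) R :=
  Matrix.of fun i j => QuadraticMap.polar q (Pi.single i 1) (Pi.single j 1)

/-- Discriminant: determinant of the Gram matrix (well defined up to squares). -/
def discQF {R : Type*} [CommRing R] {n : ℕ} (q : QuadraticForm R (Fin n → R)) : R :=
  (polarMatrix q).det

/-- Nondegeneracy (char ≠ 2): the Gram determinant is nonzero. -/
def NondegQF {R : Type*} [CommRing R] {n : ℕ} (q : QuadraticForm R (Fin n → R)) : Prop :=
  discQF q ≠ 0

/-- Two quadratic forms are similar if one is isometric to a unit scaling of the other. -/
def SimilarQF {R : Type*} [CommRing R] {n : ℕ} (q q' : QuadraticForm R (Fin n → R)) : Prop :=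
  ∃ c : R, IsUnit c ∧ QuadraticMap.Equivalent (c • q) q'

/-- The polynomial `q(X₁, …, X_{n-1}, 1)` defining the affine quadric. -/
def affineQuadricPoly {R : Type*} [CommRing R] {n : ℕ} (q : QuadraticForm R (Fin n → R)) :
    MvPolynomial (Fin (n - 1)) R :=
  (extendQF q (MvPolynomial (Fin (n - 1)) R))
    (fun i => if h : (i : ℕ) < n - 1 then MvPolynomial.X ⟨i, h⟩ else 1)

/-- Affine coordinate ring `R[x₁,…,x_{n-1}]/(q(x₁,…,x_{n-1},1))` of the quadric. -/
abbrev quadricCoordRing {R : Type*} [CommRing R] {n : ℕ}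
    (q : QuadraticForm R (Fin n → R)) : Type _ :=
  MvPolynomial (Fin (n - 1)) R ⧸ Ideal.span {affineQuadricPoly q}

/-- Function field `k(q)` of the quadric hypersurface `q = 0`. -/
abbrev quadricFunctionField {R : Type*} [CommRing R] {n : ℕ}
    (q : QuadraticForm R (Fin n → R)) : Type _ :=
  FractionRing (quadricCoordRing q)

/-- Affine coordinate ring `k[x,y]/(ax²+by²-1)` of the conic `C_{a,b}`. -/
abbrev conicCoordRing (k : Type*) [Field k] (a b : k) : Type _ :=
  MvPolynomial (Fin 2) k ⧸
    Ideal.span {(MvPolynomial.C a * MvPolynomial.X 0 ^ 2 +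
      MvPolynomial.C b * MvPolynomial.X 1 ^ 2 - 1 : MvPolynomial (Fin 2) k)}

/-- The conic function field `k(C_{a,b})`. -/
abbrev conicFunctionField (k : Type*) [Field k] (a b : k) : Type _ :=
  FractionRing (conicCoordRing k a b)

/-- A `k`-algebra is split if it is isomorphic to a matrix algebra over `k`. -/
def IsSplitAlg (k A : Type*) [Field k] [Ring A] [Algebra k A] : Prop :=
  ∃ n : ℕ, 0 < n ∧ Nonempty (A ≃ₐ[k] Matrix (Fin n) (Fin n) k)

/-- `A` is split by the extension `K/k`: the class of `A` lies in the Brauer kernel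
`κ(K/k) = ker (Br k → Br K)`. -/
def SplitsIn (k : Type*) [Field k] (A : Type*) [Ring A] [Algebra k A]
    (K : Type*) [CommRing K] [Algebra k K] : Prop :=
  ∃ n : ℕ, 0 < n ∧ Nonempty ((K ⊗[k] A) ≃ₐ[K] Matrix (Fin n) (Fin n) K)

/-- Brauer equivalence of two `k`-algebras. -/
def BrauerEquiv (k A B : Type*) [Field k] [Ring A] [Algebra k A] [Ring B] [Algebra k B] :
    Prop :=
  ∃ n m : ℕ, 0 < n ∧ 0 < m ∧
    Nonempty (Matrix (Fin n) (Fin n) A ≃ₐ[k] Matrix (Fin m) (Fin m) B)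

/-- A field is finitely generated (over its prime subfield). -/
def FieldFG (K : Type*) [Field K] : Prop :=
  ∃ s : Finset K, Subfield.closure (s : Set K) = ⊤

/-- Elementary equivalence in the first-order language of rings. -/
def ElemEquivRing (K₁ : Type*) (K₂ : Type*) [CommRing K₁] [CommRing K₂] : Prop :=
  letI := FirstOrder.Ring.compatibleRingOfRing K₁
  letI := FirstOrder.Ring.compatibleRingOfRing K₂
  FirstOrder.Language.ring.ElementarilyEquivalent K₁ K₂

/-- The `m`-fold Pfister form `⟨⟨a₁,…,aₘ⟩⟩ = ⟨1,a₁⟩ ⊗ ⋯ ⊗ ⟨1,aₘ⟩`. -/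
def pfisterForm {k : Type*} [Field k] {m : ℕ} (a : Fin m → k) :
    QuadraticForm k (Fin (2 ^ m) → k) :=
  QuadraticMap.weightedSumSquares k
    (fun j : Fin (2 ^ m) => ∏ i : Fin m, if Nat.testBit (j : ℕ) (i : ℕ) then a i else 1)

/-! ### Quadratic forms on `Fin n → R` and their scalar extensions -/

theorem extendQF_apply {R : Type*} [CommRing R] {n : ℕ} (q : QuadraticForm R (Fin n → R))
    (S : Type*) [CommRing S] [Algebra R S] (x : Fin n → S) :
    extendQF q S x = ∑ i, ∑ j, x i * x j * algebraMap R S (coeffMatrix q i j) := by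
  change Matrix.toLinearMap₂' S _ x x = _
  rw [Matrix.toLinearMap₂'_apply]
  simp [mul_assoc]

theorem quadraticForm_apply_eq_sum {R : Type*} [CommRing R] {n : ℕ}
    (q : QuadraticForm R (Fin n → R)) (x : Fin n → R) :
    q x = ∑ i, ∑ j, x i * x j * coeffMatrix q i j := by
  conv_lhs => rw [← QuadraticMap.toQuadraticMap_toBilin q (Pi.basisFun R (Fin n))]
  rw [LinearMap.BilinMap.toQuadraticMap_apply]
  conv_lhs => rw [← (Pi.basisFun R (Fin n)).sum_repr x]
  simp only [map_sum, LinearMap.sum_apply, map_smul, LinearMap.smul_apply,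
    QuadraticMap.toBilin_apply]
  simp_rw [Finset.smul_sum]
  rw [Finset.sum_comm]
  refine Finset.sum_congr rfl fun i _ => Finset.sum_congr rfl fun j _ => ?_
  simp [coeffMatrix, mul_assoc, mul_left_comm]

theorem extendQF_self {R : Type*} [CommRing R] {n : ℕ} (q : QuadraticForm R (Fin n → R)) :
    extendQF q R = q := by
  ext x
  rw [extendQF_apply, quadraticForm_apply_eq_sum q]
  rfl

theorem extendQF_map {R : Type*} [CommRing R] {n : ℕ} (q : QuadraticForm R (Fin n → R))
    {S T : Type*} [CommRing S] [Algebra R S] [CommRing T] [Algebra R T] (f : S →ₐ[R] T)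
    (x : Fin n → S) : f (extendQF q S x) = extendQF q T (fun i => f (x i)) := by
  simp [extendQF_apply]

theorem extendQF_algebraMap {R : Type*} [CommRing R] {n : ℕ} (q : QuadraticForm R (Fin n → R))
    (S : Type*) [CommRing S] [Algebra R S] (x : Fin n → R) :
    extendQF q S (fun i => algebraMap R S (x i)) = algebraMap R S (q x) := by
  rw [extendQF_apply, quadraticForm_apply_eq_sum q]
  simp

/-- A quadratic form over `S` is determined by its values at vectors coming from a ring mapping
to `S`. -/
theorem quadraticForm_ext_of_algebraMap {R : Type*} [CommRing R] {n : ℕ} {S : Type*} [CommRing S]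
    [Algebra R S] {Q₁ Q₂ : QuadraticForm S (Fin n → S)}
    (h : ∀ x : Fin n → R, Q₁ (fun i => algebraMap R S (x i)) = Q₂ (fun i => algebraMap R S (x i))) :
    Q₁ = Q₂ := by
  have single (i : Fin n) : (Pi.single i 1 : Fin n → S) =
      fun j => algebraMap R S ((Pi.single i 1 : Fin n → R) j) := by
    ext j
    by_cases hj : j = i
    · subst hj; simp
    · simp [hj]
  have hs (i : Fin n) : Q₁ (Pi.single i 1) = Q₂ (Pi.single i 1) := by rw [single, h]
  have hp (i j : Fin n) : QuadraticMap.polar Q₁ (Pi.single i 1) (Pi.single j 1) =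
      QuadraticMap.polar Q₂ (Pi.single i 1) (Pi.single j 1) := by
    simp only [QuadraticMap.polar, hs]
    congr 2
    rw [single i, single j]
    have hij := h (Pi.single i 1 + Pi.single j 1)
    simp only [Pi.add_apply, map_add] at hij
    exact hij
  ext x
  rw [quadraticForm_apply_eq_sum Q₁, quadraticForm_apply_eq_sum Q₂]
  refine Finset.sum_congr rfl fun i _ => Finset.sum_congr rfl fun j _ => ?_
  simp [coeffMatrix, hs, hp]

theorem extendQF_extendQF {R : Type*} [CommRing R] {n : ℕ} (q : QuadraticForm R (Fin n → R))
    (S T : Type*) [CommRing S] [Algebra R S] [CommRing T] [Algebra R T] [Algebra S T]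
    [IsScalarTower R S T] : extendQF (extendQF q S) T = extendQF q T := by
  refine quadraticForm_ext_of_algebraMap (R := R) fun x => ?_
  rw [extendQF_algebraMap]
  simp only [IsScalarTower.algebraMap_apply R S T]
  rw [extendQF_algebraMap, extendQF_algebraMap]

theorem extendQF_mulVec {R : Type*} [CommRing R] {n : ℕ} {q q' : QuadraticForm R (Fin n → R)}
    {c : R} {M : Matrix (Fin n) (Fin n) R} (h : ∀ x, q' (M.mulVec x) = c * q x)
    (S : Type*) [CommRing S] [Algebra R S] (y : Fin n → S) :
    extendQF q' S ((M.map (algebraMap R S)).mulVec y) = algebraMap R S c * extendQF q S y := by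
  have : (extendQF q' S).comp (Matrix.toLin' (M.map (algebraMap R S))) =
      algebraMap R S c • extendQF q S := by
    refine quadraticForm_ext_of_algebraMap (R := R) fun x => ?_
    rw [QuadraticMap.comp_apply, smul_apply, extendQF_algebraMap, Matrix.toLin'_apply]
    have := extendQF_algebraMap q' S (M.mulVec x)
    rw [h] at this
    rw [smul_eq_mul, ← map_mul, ← this]
    congr 1
    ext i
    simp [Matrix.mulVec, dotProduct]
  simpa [Algebra.smul_def] using congrArg (fun Q : QuadraticForm S (Fin n → S) => Q y) this

/-! ### Fraction rings -/

theorem nonempty_fractionRing_algEquiv_of_isLocalization (k : Type*) {A B : Type*} [CommRing k]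
    [CommRing A] [CommRing B] [Algebra k A] [Algebra k B] [Algebra A B] [IsScalarTower k A B]
    (M : Submonoid A) [IsLocalization M B] (hM : M ≤ nonZeroDivisors A) :
    Nonempty (FractionRing A ≃ₐ[k] FractionRing B) := by
  have hu : ∀ y : M, IsUnit (algebraMap A (FractionRing A) y) := fun y =>
    IsLocalization.map_units _ (⟨y, hM y.2⟩ : nonZeroDivisors A)
  let f : B →+* FractionRing A := IsLocalization.lift hu
  let : Algebra B (FractionRing A) := f.toAlgebra
  have : IsScalarTower A B (FractionRing A) := IsScalarTower.of_algebraMap_eq fun x =>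
    (IsLocalization.lift_eq hu x).symm
  have : IsScalarTower k B (FractionRing A) := IsScalarTower.of_algebraMap_eq fun x => by
    rw [IsScalarTower.algebraMap_apply k A B, ← IsScalarTower.algebraMap_apply A B (FractionRing A),
      ← IsScalarTower.algebraMap_apply k A (FractionRing A)]
  have : IsFractionRing B (FractionRing A) :=
    IsFractionRing.isFractionRing_of_isLocalization M B (FractionRing A) hM
  exact ⟨((FractionRing.algEquiv B (FractionRing A)).restrictScalars k).symm⟩

theorem nonempty_fractionRing_algEquiv {k A B : Type*} [CommRing k]
    [CommRing A] [CommRing B] [Algebra k A] [Algebra k B] (e : A ≃ₐ[k] B) :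
    Nonempty (FractionRing A ≃ₐ[k] FractionRing B) := 
  ⟨IsFractionRing.algEquivOfAlgEquiv e⟩

/-! ### The affine quadric and its generic point -/

/-- The tuple `(X₁, …, X_{n-1}, 1)`. -/
def affinePoint (n : ℕ) (R : Type*) [CommRing R] : Fin n → MvPolynomial (Fin (n - 1)) R :=
  fun i => if h : (i : ℕ) < n - 1 then MvPolynomial.X ⟨i, h⟩ else 1

theorem affineQuadricPoly_eq {R : Type*} [CommRing R] {n : ℕ} (q : QuadraticForm R (Fin n → R)) :
    affineQuadricPoly q = extendQF q (MvPolynomial (Fin (n - 1)) R) (affinePoint n R) := rfl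

/-- The generic point of the affine quadric. -/
def coordPoint {R : Type*} [CommRing R] {n : ℕ} (q : QuadraticForm R (Fin n → R)) :
    Fin n → quadricCoordRing q :=
  fun i => Ideal.Quotient.mkₐ R _ (affinePoint n R i)

theorem extendQF_coordPoint {R : Type*} [CommRing R] {n : ℕ} (q : QuadraticForm R (Fin n → R)) :
    extendQF q (quadricCoordRing q) (coordPoint q) = 0 := by
  unfold coordPoint
  rw [← extendQF_map, ← affineQuadricPoly_eq]
  exact Ideal.Quotient.eq_zero_iff_mem.mpr (Ideal.subset_span rfl)

/-- The homomorphism to `S` attached to an `S`-point of the affine quadric. -/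
def coordLift {R : Type*} [CommRing R] {n : ℕ} (q : QuadraticForm R (Fin n → R))
    {S : Type*} [CommRing S] [Algebra R S] (v : Fin n → S) (hv : extendQF q S v = 0)
    (h1 : ∀ i : Fin n, ¬ (i : ℕ) < n - 1 → v i = 1) : quadricCoordRing q →ₐ[R] S :=
  Ideal.Quotient.liftₐ _
    (MvPolynomial.aeval fun i : Fin (n - 1) => v ⟨i, i.2.trans_le (Nat.sub_le n 1)⟩) (by
      have hp : ∀ i, MvPolynomial.aeval (fun i : Fin (n - 1) =>
          v ⟨i, i.2.trans_le (Nat.sub_le n 1)⟩) (affinePoint n R i) = v i := by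
        intro i
        unfold affinePoint
        split_ifs with h
        · simp
        · simp [h1 i h]
      intro a ha
      obtain ⟨b, rfl⟩ := Ideal.mem_span_singleton'.mp ha
      rw [map_mul, affineQuadricPoly_eq, extendQF_map]
      simp [hp, hv])

theorem coordLift_coordPoint {R : Type*} [CommRing R] {n : ℕ} (q : QuadraticForm R (Fin n → R))
    {S : Type*} [CommRing S] [Algebra R S] (v : Fin n → S) (hv : extendQF q S v = 0)
    (h1 : ∀ i : Fin n, ¬ (i : ℕ) < n - 1 → v i = 1) (i : Fin n) :
    coordLift q v hv h1 (coordPoint q i) = v i := by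
  change MvPolynomial.aeval _ (affinePoint n R i) = v i
  unfold affinePoint
  split_ifs with h
  · simp
  · simp [h1 i h]

theorem coordPoint_last {R : Type*} [CommRing R] {n : ℕ} (q : QuadraticForm R (Fin n → R))
    (i : Fin n) (hi : ¬ (i : ℕ) < n - 1) : coordPoint q i = 1 := by
  simp [coordPoint, affinePoint, hi]

theorem quadricCoordRing_algHom_ext {R : Type*} [CommRing R] {n : ℕ}
    {q : QuadraticForm R (Fin n → R)} {S : Type*} [CommRing S] [Algebra R S]
    {f g : quadricCoordRing q →ₐ[R] S} (h : ∀ i, f (coordPoint q i) = g (coordPoint q i)) :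
    f = g := by
  refine Ideal.Quotient.algHom_ext _ (MvPolynomial.algHom_ext fun i => ?_)
  have := h ⟨i, i.2.trans_le (Nat.sub_le n 1)⟩
  simpa [coordPoint, affinePoint] using this

/-! ### Irreducibility of quadrics of rank four -/

theorem polarMatrix_eq {R : Type*} [CommRing R] {n : ℕ} (q : QuadraticForm R (Fin n → R))
    (i j : Fin n) : polarMatrix q i j = coeffMatrix q i j + coeffMatrix q j i := by
  rcases lt_trichotomy i j with h | rfl | h
  · simp [polarMatrix, coeffMatrix, h, h.ne, h.ne', h.not_gt]
  · simp [polarMatrix, coeffMatrix, two_mul]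
  · simp [polarMatrix, coeffMatrix, h, h.ne, h.ne', h.not_gt, QuadraticMap.polar_comm]

theorem MvPolynomial.exists_eq_of_totalDegree_le_one {R : Type*} [CommRing R]
    (f : MvPolynomial (Fin (4 - 1)) R) (hf : f.totalDegree ≤ 1) :
    ∃ a b c d : R, f = MvPolynomial.C d + MvPolynomial.C a * MvPolynomial.X 0 +
      MvPolynomial.C b * MvPolynomial.X 1 + MvPolynomial.C c * MvPolynomial.X 2 := by
  classical
  refine ⟨f.coeff (Finsupp.single 0 1), f.coeff (Finsupp.single 1 1), f.coeff (Finsupp.single 2 1),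
    f.coeff 0, ?_⟩
  ext m
  by_cases hm : m.degree ≤ 1
  · have hm' : m = 0 ∨ ∃ i, m = Finsupp.single i 1 := by
      rcases Nat.le_one_iff_eq_zero_or_eq_one.mp hm with h | h
      · exact Or.inl ((Finsupp.degree_eq_zero_iff m).mp h)
      · obtain ⟨i, hi⟩ : ∃ i, m i ≠ 0 := by
          by_contra! hc
          rw [show m = 0 from Finsupp.ext hc] at h
          simp at h
        refine Or.inr ⟨i, ?_⟩
        rw [Finsupp.degree_eq_sum] at h
        ext j
        rw [← Finset.add_sum_erase _ _ (Finset.mem_univ i)] at h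
        by_cases hj : j = i
        · subst hj
          rw [Finsupp.single_eq_same]
          omega
        · rw [Finsupp.single_eq_of_ne hj]
          have := Finset.single_le_sum (f := fun j => m j) (fun j _ => Nat.zero_le _)
            (Finset.mem_erase.mpr ⟨hj, Finset.mem_univ j⟩)
          omega
    rcases hm' with rfl | ⟨i, rfl⟩
    · simp
    · fin_cases i <;>
        simp [MvPolynomial.coeff_C, MvPolynomial.coeff_C_mul, MvPolynomial.coeff_X,
          Finsupp.single_left_inj, (Finsupp.single_ne_zero.mpr (one_ne_zero (α := ℕ))).symm]
  · have h0 : f.coeff m = 0 := by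
      refine MvPolynomial.coeff_eq_zero_of_totalDegree_lt (lt_of_le_of_lt hf ?_)
      simpa [Finsupp.degree] using hm
    have h1 : ∀ i, Finsupp.single i 1 ≠ m := by
      rintro i rfl
      simp at hm
    have h2 : 0 ≠ m := by
      rintro rfl
      simp at hm
    simp [h0, MvPolynomial.coeff_C, MvPolynomial.coeff_C_mul, MvPolynomial.coeff_X, h1, h2]

theorem eval_affineQuadricPoly {R : Type*} [CommRing R] (q : QuadraticForm R (Fin 4 → R))
    (y : Fin (4 - 1) → R) :
    MvPolynomial.eval y (affineQuadricPoly q) = q ![y 0, y 1, y 2, 1] := by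
  have h : MvPolynomial.aeval y (affineQuadricPoly q) = q ![y 0, y 1, y 2, 1] := by
    rw [affineQuadricPoly_eq, extendQF_map, extendQF_self]
    congr 1
    ext i
    fin_cases i <;> simp [affinePoint]
  simpa [MvPolynomial.aeval_eq_eval] using h

theorem discQF_eq_zero_of_affineQuadricPoly_eq_mul {k : Type*} [Field k] (h2 : (2 : k) ≠ 0)
    (q : QuadraticForm k (Fin 4 → k)) {f g : MvPolynomial (Fin (4 - 1)) k}
    (hf : f.totalDegree ≤ 1) (hg : g.totalDegree ≤ 1) (h : affineQuadricPoly q = f * g) :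
    discQF q = 0 := by
  obtain ⟨a, b, c, d, rfl⟩ := f.exists_eq_of_totalDegree_le_one hf
  obtain ⟨a', b', c', d', rfl⟩ := g.exists_eq_of_totalDegree_le_one hg
  have key (x y z : k) : q ![x, y, z, 1] =
      (d + a * x + b * y + c * z) * (d' + a' * x + b' * y + c' * z) := by
    have := congrArg (MvPolynomial.eval (![x, y, z] : Fin (4 - 1) → k)) h
    rw [eval_affineQuadricPoly] at this
    simpa using this
  have low {i j : Fin 4} (hij : j < i) : coeffMatrix q i j = 0 := by
    simp [coeffMatrix, hij.ne', hij.not_gt]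
  simp only [quadraticForm_apply_eq_sum q, Fin.sum_univ_four] at key
  simp only [low (show (0 : Fin 4) < 1 by decide), low (show (0 : Fin 4) < 2 by decide),
    low (show (0 : Fin 4) < 3 by decide), low (show (1 : Fin 4) < 2 by decide),
    low (show (1 : Fin 4) < 3 by decide), low (show (2 : Fin 4) < 3 by decide)] at key
  have e33 : coeffMatrix q 3 3 = d * d' := by simpa using key 0 0 0
  have half {x y : k} (hxy : 2 * x = 2 * y) : x = y := mul_left_cancel₀ h2 hxy
  have px := key 1 0 0
  have mx := key (-1) 0 0
  have py := key 0 1 0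
  have my := key 0 (-1) 0
  have pz := key 0 0 1
  have mz := key 0 0 (-1)
  have xy := key 1 1 0
  have xz := key 1 0 1
  have yz := key 0 1 1
  simp only [Matrix.cons_val_zero, Matrix.cons_val_one, Matrix.cons_val] at px mx py my pz mz xy xz yz
  have e00 : coeffMatrix q 0 0 = a * a' := half (by linear_combination px + mx - 2 * e33)
  have e11 : coeffMatrix q 1 1 = b * b' := half (by linear_combination py + my - 2 * e33)
  have e22 : coeffMatrix q 2 2 = c * c' := half (by linear_combination pz + mz - 2 * e33)
  have e03 : coeffMatrix q 0 3 = a * d' + d * a' := half (by linear_combination px - mx)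
  have e13 : coeffMatrix q 1 3 = b * d' + d * b' := half (by linear_combination py - my)
  have e23 : coeffMatrix q 2 3 = c * d' + d * c' := half (by linear_combination pz - mz)
  have e01 : coeffMatrix q 0 1 = a * b' + b * a' := by
    linear_combination xy - e00 - e11 - e33 - e03 - e13
  have e02 : coeffMatrix q 0 2 = a * c' + c * a' := by
    linear_combination xz - e00 - e22 - e33 - e03 - e23
  have e12 : coeffMatrix q 1 2 = b * c' + c * b' := by
    linear_combination yz - e11 - e22 - e33 - e13 - e23
  have hM : polarMatrix q = Matrix.of fun i j =>
      ![a, b, c, d] i * ![a', b', c', d'] j + ![a, b, c, d] j * ![a', b', c', d'] i := by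
    ext i j
    rw [polarMatrix_eq]
    fin_cases i <;> fin_cases j <;>
      simp [e00, e11, e22, e33, e01, e02, e03, e12, e13, e23,
        low (show (0 : Fin 4) < 1 by decide), low (show (0 : Fin 4) < 2 by decide),
        low (show (0 : Fin 4) < 3 by decide), low (show (1 : Fin 4) < 2 by decide),
        low (show (1 : Fin 4) < 3 by decide), low (show (2 : Fin 4) < 3 by decide)] <;> ring
  rw [discQF, hM]
  simp [Matrix.det_succ_row_zero, Fin.sum_univ_succ, Fin.succAbove]
  ring

theorem totalDegree_affineQuadricPoly_le {R : Type*} [CommRing R] [Nontrivial R] {n : ℕ}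
    (q : QuadraticForm R (Fin n → R)) : (affineQuadricPoly q).totalDegree ≤ 2 := by
  have hp (i : Fin n) : (affinePoint n R i).totalDegree ≤ 1 := by
    unfold affinePoint
    split_ifs
    · exact (MvPolynomial.totalDegree_X _).le
    · simp
  rw [affineQuadricPoly_eq, extendQF_apply]
  refine MvPolynomial.totalDegree_finsetSum_le fun i _ =>
    MvPolynomial.totalDegree_finsetSum_le fun j _ => ?_
  refine (MvPolynomial.totalDegree_mul _ _).trans ?_
  rw [MvPolynomial.algebraMap_eq, MvPolynomial.totalDegree_C, add_zero]
  exact (MvPolynomial.totalDegree_mul _ _).trans (add_le_add (hp i) (hp j))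

theorem affineQuadricPoly_ne_zero {k : Type*} [Field k] (h2 : (2 : k) ≠ 0)
    {q : QuadraticForm k (Fin 4 → k)} (hq : NondegQF q) : affineQuadricPoly q ≠ 0 := fun h =>
  hq (discQF_eq_zero_of_affineQuadricPoly_eq_mul h2 q (f := 0) (g := 0) (by simp) (by simp)
    (by simpa using h))

theorem totalDegree_affineQuadricPoly {k : Type*} [Field k] (h2 : (2 : k) ≠ 0)
    {q : QuadraticForm k (Fin 4 → k)} (hq : NondegQF q) :
    (affineQuadricPoly q).totalDegree = 2 := by
  refine (totalDegree_affineQuadricPoly_le q).antisymm (not_lt.mp fun h => hq ?_)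
  exact discQF_eq_zero_of_affineQuadricPoly_eq_mul h2 q (g := 1) (Nat.le_of_lt_succ h) (by simp)
    (mul_one _).symm

theorem irreducible_affineQuadricPoly {k : Type*} [Field k] (h2 : (2 : k) ≠ 0)
    {q : QuadraticForm k (Fin 4 → k)} (hq : NondegQF q) : Irreducible (affineQuadricPoly q) := by
  have hd := totalDegree_affineQuadricPoly h2 hq
  constructor
  · intro hu
    rw [MvPolynomial.isUnit_iff_totalDegree_of_isReduced] at hu
    omega
  · intro f g hfg
    by_contra! hn
    have h0 := affineQuadricPoly_ne_zero h2 hq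
    rw [hfg] at h0
    have hf0 := left_ne_zero_of_mul h0
    have hg0 := right_ne_zero_of_mul h0
    have hdeg {p : MvPolynomial (Fin (4 - 1)) k} (hp : p ≠ 0) (hu : ¬ IsUnit p) :
        p.totalDegree ≠ 0 := by
      intro h
      rw [MvPolynomial.totalDegree_eq_zero_iff_eq_C.mp h] at hp hu
      exact hu ((isUnit_iff_ne_zero.mpr fun h => hp (by rw [h, map_zero])).map MvPolynomial.C)
    have hf := hdeg hf0 hn.1
    have hg := hdeg hg0 hn.2
    have hs := MvPolynomial.totalDegree_mul_of_isDomain hf0 hg0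
    rw [← hfg, hd] at hs
    exact hq (discQF_eq_zero_of_affineQuadricPoly_eq_mul h2 q (f := f) (g := g) (by omega)
      (by omega) hfg)

theorem isDomain_quadricCoordRing {k : Type*} [Field k] (h2 : (2 : k) ≠ 0)
    {q : QuadraticForm k (Fin 4 → k)} (hq : NondegQF q) : IsDomain (quadricCoordRing q) := by
  have := (Ideal.span_singleton_prime (affineQuadricPoly_ne_zero h2 hq)).mpr
    (irreducible_affineQuadricPoly h2 hq).prime
  exact Ideal.Quotient.isDomain _

/-- A nonzero linear form does not vanish at the generic point of a quadric. -/
theorem sum_mul_coordPoint_ne_zero {k : Type*} [Field k] (h2 : (2 : k) ≠ 0)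
    {q : QuadraticForm k (Fin 4 → k)} (hq : NondegQF q) {a : Fin 4 → k} (ha : a ≠ 0) :
    ∑ i, algebraMap k (quadricCoordRing q) (a i) * coordPoint q i ≠ 0 := by
  intro h
  have hmk : Ideal.Quotient.mkₐ k (Ideal.span {affineQuadricPoly q})
      (∑ i, MvPolynomial.C (a i) * affinePoint 4 k i) = 0 := by
    rw [← h, map_sum]
    rfl
  obtain ⟨r, hr⟩ := Ideal.mem_span_singleton.mp (Ideal.Quotient.eq_zero_iff_mem.mp hmk)
  have hle : (∑ i, MvPolynomial.C (a i) * affinePoint 4 k i).totalDegree ≤ 1 := by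
    refine MvPolynomial.totalDegree_finsetSum_le fun i _ => ?_
    refine (MvPolynomial.totalDegree_mul _ _).trans ?_
    rw [MvPolynomial.totalDegree_C, zero_add]
    unfold affinePoint
    split_ifs
    · exact (MvPolynomial.totalDegree_X _).le
    · simp
  by_cases hr0 : r = 0
  · rw [hr0, mul_zero] at hr
    have hev (y : Fin (4 - 1) → k) : a 0 * y 0 + a 1 * y 1 + a 2 * y 2 + a 3 = 0 := by
      have := congrArg (MvPolynomial.eval y) hr
      simpa [Fin.sum_univ_four, affinePoint] using this
    have h3 : a 3 = 0 := by simpa using hev 0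
    have h0 : a 0 = 0 := by simpa [h3] using hev (![1, 0, 0] : Fin 3 → k)
    have h1 : a 1 = 0 := by simpa [h3] using hev (![0, 1, 0] : Fin 3 → k)
    have h2 : a 2 = 0 := by simpa [h3] using hev (![0, 0, 1] : Fin 3 → k)
    exact ha (by ext i; fin_cases i <;> assumption)
  · rw [hr, MvPolynomial.totalDegree_mul_of_isDomain (affineQuadricPoly_ne_zero h2 hq) hr0,
      totalDegree_affineQuadricPoly h2 hq] at hle
    omega

/-! ### Similar forms have isomorphic function fields -/

/-- The image of the generic point of a quadric under a linear substitution. -/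
def movedPoint {k : Type*} [CommRing k] {n : ℕ} (q : QuadraticForm k (Fin n → k))
    (M : Matrix (Fin n) (Fin n) k) : Fin n → quadricCoordRing q :=
  (M.map (algebraMap k (quadricCoordRing q))).mulVec (coordPoint q)

theorem movedPoint_apply {k : Type*} [CommRing k] {n : ℕ} (q : QuadraticForm k (Fin n → k))
    (M : Matrix (Fin n) (Fin n) k) (i : Fin n) :
    movedPoint q M i = ∑ j, algebraMap k (quadricCoordRing q) (M i j) * coordPoint q j := rfl

theorem map_movedPoint {k : Type*} [CommRing k] {n : ℕ} (q : QuadraticForm k (Fin n → k))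
    (M : Matrix (Fin n) (Fin n) k) {S : Type*} [CommRing S] [Algebra k S]
    (f : quadricCoordRing q →ₐ[k] S) (i : Fin n) :
    f (movedPoint q M i) = ∑ j, algebraMap k S (M i j) * f (coordPoint q j) := by
  simp [movedPoint_apply]

theorem exists_algHom_away {k : Type*} [Field k] {q q' : QuadraticForm k (Fin 4 → k)}
    {M N : Matrix (Fin 4) (Fin 4) k} (hNM : N * M = 1) {c : k}
    (h : ∀ x, q' (M.mulVec x) = c * q x) :
    ∃ f : Localization.Away (movedPoint q' N 3) →ₐ[k] Localization.Away (movedPoint q M 3),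
      ∀ i, f (algebraMap _ _ (coordPoint q' i)) * algebraMap _ _ (movedPoint q M 3) =
        algebraMap _ _ (movedPoint q M i) := by
  set B := Localization.Away (movedPoint q M 3)
  set w := movedPoint q M with hw
  have hwq : extendQF q' _ w = 0 := by
    rw [hw, movedPoint, extendQF_mulVec h, extendQF_coordPoint, mul_zero]
  obtain ⟨t, ht⟩ : ∃ t : B, algebraMap _ B (w 3) * t = 1 :=
    (IsLocalization.Away.algebraMap_isUnit (S := B) (w 3)).exists_right_inv
  have hpt : extendQF q' B (fun i => algebraMap _ B (w i) * t) = 0 := by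
    have e : (fun i => algebraMap _ B (w i) * t) =
        t • fun i => IsScalarTower.toAlgHom k (quadricCoordRing q) B (w i) := by
      ext i
      simp [mul_comm]
    rw [e, QuadraticMap.map_smul, ← extendQF_map, hwq, map_zero, smul_zero]
  have hlast (i : Fin 4) (hi : ¬ (i : ℕ) < 4 - 1) : algebraMap _ B (w i) * t = 1 := by
    obtain rfl : i = 3 := by omega
    exact ht
  let f₀ := coordLift q' _ hpt hlast
  have hf₀ (i) : f₀ (coordPoint q' i) = algebraMap _ B (w i) * t :=
    coordLift_coordPoint q' _ hpt hlast i
  have hN : f₀ (movedPoint q' N 3) = t := by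
    have e : (N.map (algebraMap k _)).mulVec w = coordPoint q := by
      rw [hw, movedPoint, Matrix.mulVec_mulVec, ← Matrix.map_mul, hNM]
      simp
    have e3 := congrFun e 3
    rw [coordPoint_last q 3 (by decide)] at e3
    simp only [Matrix.mulVec, dotProduct, Matrix.map_apply] at e3
    refine (map_movedPoint q' N f₀ 3).trans ?_
    simp only [hf₀, ← mul_assoc]
    rw [← Finset.sum_mul]
    have := congrArg (algebraMap _ B) e3
    simp only [map_sum, map_mul, map_one, ← IsScalarTower.algebraMap_apply] at this
    rw [this, one_mul]
  have hu : ∀ y : Submonoid.powers (movedPoint q' N 3), IsUnit (f₀ y) := by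
    rintro ⟨_, m, rfl⟩
    rw [map_pow, hN]
    exact (IsUnit.of_mul_eq_one_right _ ht).pow m
  refine ⟨IsLocalization.liftAlgHom (M := Submonoid.powers (movedPoint q' N 3)) (f := f₀) hu,
    fun i => ?_⟩
  rw [IsLocalization.liftAlgHom_apply, IsLocalization.lift_eq]
  change f₀ (coordPoint q' i) * _ = _
  rw [hf₀, mul_assoc, mul_comm t, ht, mul_one]

theorem algHom_away_comp {k : Type*} [Field k] {q q' : QuadraticForm k (Fin 4 → k)}
    {M N : Matrix (Fin 4) (Fin 4) k} (hMN : M * N = 1)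
    (f : Localization.Away (movedPoint q' N 3) →ₐ[k] Localization.Away (movedPoint q M 3))
    (g : Localization.Away (movedPoint q M 3) →ₐ[k] Localization.Away (movedPoint q' N 3))
    (hf : ∀ i, f (algebraMap _ _ (coordPoint q' i)) * algebraMap _ _ (movedPoint q M 3) =
        algebraMap _ _ (movedPoint q M i))
    (hg : ∀ i, g (algebraMap _ _ (coordPoint q i)) * algebraMap _ _ (movedPoint q' N 3) =
        algebraMap _ _ (movedPoint q' N i)) :
    g.comp f = AlgHom.id k _ := by
  set B' := Localization.Away (movedPoint q' N 3)
  have key (i) : g (algebraMap _ _ (movedPoint q M i)) * algebraMap _ B' (movedPoint q' N 3) =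
      algebraMap _ B' (coordPoint q' i) := by
    have e : (M.map (algebraMap k _)).mulVec (movedPoint q' N) = coordPoint q' := by
      rw [movedPoint, Matrix.mulVec_mulVec, ← Matrix.map_mul, hMN]
      simp
    have ei := congrArg (algebraMap _ B') (congrFun e i)
    simp only [Matrix.mulVec, dotProduct, Matrix.map_apply] at ei
    have hgi := map_movedPoint q M (g.comp (IsScalarTower.toAlgHom k _ _)) i
    simp only [AlgHom.comp_apply, IsScalarTower.coe_toAlgHom'] at hgi
    rw [← ei, hgi, map_sum, Finset.sum_mul]
    refine Finset.sum_congr rfl fun j _ => ?_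
    rw [map_mul, mul_assoc, hg, ← IsScalarTower.algebraMap_apply]
  have key3 := key 3
  rw [coordPoint_last q' 3 (by decide), map_one] at key3
  refine IsLocalization.algHom_ext (Submonoid.powers (movedPoint q' N 3)) ?_
  refine quadricCoordRing_algHom_ext fun i => ?_
  change g (f (algebraMap _ B' (coordPoint q' i))) = algebraMap _ B' (coordPoint q' i)
  calc g (f (algebraMap _ B' (coordPoint q' i)))
      = g (f (algebraMap _ B' (coordPoint q' i))) * (g (algebraMap _ _ (movedPoint q M 3)) *
        algebraMap _ B' (movedPoint q' N 3)) := by rw [key3, mul_one]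
    _ = _ := by rw [← mul_assoc, ← map_mul, hf, key]

theorem nonempty_functionField_algEquiv_of_mulVec {k : Type*} [Field k] (h2 : (2 : k) ≠ 0)
    {q q' : QuadraticForm k (Fin 4 → k)} (hq : NondegQF q) (hq' : NondegQF q')
    {M : Matrix (Fin 4) (Fin 4) k} (hM : M.det ≠ 0) {c : k} (hc : c ≠ 0)
    (h : ∀ x, q' (M.mulVec x) = c * q x) :
    Nonempty (quadricFunctionField q ≃ₐ[k] quadricFunctionField q') := by
  have hNM : M⁻¹ * M = 1 := Matrix.nonsing_inv_mul _ (isUnit_iff_ne_zero.mpr hM)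
  have hMN : M * M⁻¹ = 1 := Matrix.mul_nonsing_inv _ (isUnit_iff_ne_zero.mpr hM)
  have h' (x) : q (M⁻¹.mulVec x) = c⁻¹ * q' x := by
    have := h (M⁻¹.mulVec x)
    rw [Matrix.mulVec_mulVec, hMN, Matrix.one_mulVec] at this
    rw [this, inv_mul_cancel_left₀ hc]
  obtain ⟨f, hf⟩ := exists_algHom_away hNM h
  obtain ⟨g, hg⟩ := exists_algHom_away hMN h'
  have := isDomain_quadricCoordRing h2 hq
  have := isDomain_quadricCoordRing h2 hq'
  have row {P Q : Matrix (Fin 4) (Fin 4) k} (hPQ : P * Q = 1) : P 3 ≠ 0 := by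
    intro h0
    have := congrFun (congrFun hPQ 3) 3
    rw [Matrix.mul_apply, h0] at this
    simp at this
  have hw : movedPoint q M 3 ≠ 0 := sum_mul_coordPoint_ne_zero h2 hq (row hMN)
  have hw' : movedPoint q' M⁻¹ 3 ≠ 0 := sum_mul_coordPoint_ne_zero h2 hq' (row hNM)
  obtain ⟨e₁⟩ := nonempty_fractionRing_algEquiv_of_isLocalization k
    (B := Localization.Away (movedPoint q M 3)) (Submonoid.powers (movedPoint q M 3))
    (powers_le_nonZeroDivisors_of_noZeroDivisors hw)
  obtain ⟨e₂⟩ := nonempty_fractionRing_algEquiv_of_isLocalization k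
    (B := Localization.Away (movedPoint q' M⁻¹ 3)) (Submonoid.powers (movedPoint q' M⁻¹ 3))
    (powers_le_nonZeroDivisors_of_noZeroDivisors hw')
  obtain ⟨e₃⟩ := nonempty_fractionRing_algEquiv
    (AlgEquiv.ofAlgHom g f (algHom_away_comp hMN f g hf hg) (algHom_away_comp hNM g f hg hf))
  exact ⟨(e₁.trans e₃).trans e₂.symm⟩

/-! ### Base change of function fields -/

/-- The coordinate ring of a quadric commutes with base change. -/
def quadricCoordRingBaseChange {k : Type*} [Field k] {n : ℕ} (q : QuadraticForm k (Fin n → k))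
    (l : Type*) [Field l] [Algebra k l] :
    l ⊗[k] quadricCoordRing q ≃ₐ[l] quadricCoordRing (extendQF q l) :=
  AlgEquiv.ofAlgHom
    (Algebra.TensorProduct.lift (Algebra.ofId l _)
      (coordLift q (coordPoint (extendQF q l))
        (by rw [← extendQF_extendQF q l (quadricCoordRing (extendQF q l)), extendQF_coordPoint])
        (fun i hi => coordPoint_last _ i hi)) (fun _ _ => Commute.all _ _))
    (coordLift (extendQF q l)
      (fun i => Algebra.TensorProduct.includeRight (R := k) (A := l) (coordPoint q i))
      (by rw [extendQF_extendQF, ← extendQF_map, extendQF_coordPoint, map_zero])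
      (fun i hi => by rw [coordPoint_last q i hi, map_one]))
    (quadricCoordRing_algHom_ext fun i => by
      simp [coordLift_coordPoint])
    (by
      refine Algebra.TensorProduct.ext (Subsingleton.elim _ _) ?_
      refine quadricCoordRing_algHom_ext (q := q) (S := l ⊗[k] quadricCoordRing q) fun i => ?_
      simp [coordLift_coordPoint])

theorem map_includeRight_nonZeroDivisors_le {k : Type*} [Field k] (l A : Type*) [Field l]
    [Algebra k l] [CommRing A] [Algebra k A] :
    (nonZeroDivisors A).map (Algebra.TensorProduct.includeRight (R := k) (A := l) (B := A)) ≤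
      nonZeroDivisors (l ⊗[k] A) := by
  rintro _ ⟨a, ha, rfl⟩
  refine mem_nonZeroDivisors_iff_right.mpr fun x hx => ?_
  have hinj : Function.Injective (LinearMap.mulLeft k a) := fun x y hxy => by
    simpa [mul_comm a, mul_cancel_right_mem_nonZeroDivisors ha] using hxy
  have h := Module.Flat.lTensor_preserves_injective_linearMap (M := l) _ hinj
  have hL : LinearMap.lTensor l (LinearMap.mulLeft k a) =
      LinearMap.mulLeft k (Algebra.TensorProduct.includeRight (R := k) (A := l) (B := A) a) := by
    ext x y
    simp
  rw [hL] at h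
  exact h (by simpa [mul_comm] using hx)

theorem nonempty_fractionRing_tensor_algEquiv {k : Type*} [Field k] (l A : Type*) [Field l]
    [Algebra k l] [CommRing A] [Algebra k A] :
    Nonempty (FractionRing (l ⊗[k] A) ≃ₐ[l] FractionRing (l ⊗[k] FractionRing A)) := by
  let φ : l ⊗[k] A →ₐ[l] l ⊗[k] FractionRing A :=
    Algebra.TensorProduct.map (AlgHom.id l l) (IsScalarTower.toAlgHom k A (FractionRing A))
  let : Algebra (l ⊗[k] A) (l ⊗[k] FractionRing A) := φ.toRingHom.toAlgebra
  have : IsScalarTower l (l ⊗[k] A) (l ⊗[k] FractionRing A) :=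
    IsScalarTower.of_algebraMap_eq fun x => (φ.commutes x).symm
  have := IsLocalization.tensorProduct_tensorProduct_right k l (nonZeroDivisors A)
    (FractionRing A) (by
      ext x
      exact Algebra.TensorProduct.map_tmul _ _ _ _)
  exact nonempty_fractionRing_algEquiv_of_isLocalization l _
    (map_includeRight_nonZeroDivisors_le l A)

theorem nonempty_functionField_extendQF_algEquiv {k : Type*} [Field k] {n : ℕ}
    {q q' : QuadraticForm k (Fin n → k)}
    (h : Nonempty (quadricFunctionField q ≃ₐ[k] quadricFunctionField q'))
    (l : Type*) [Field l] [Algebra k l] :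
    Nonempty (quadricFunctionField (extendQF q l) ≃ₐ[l] quadricFunctionField (extendQF q' l)) := by
  obtain ⟨e⟩ := h
  obtain ⟨e₁⟩ := nonempty_fractionRing_algEquiv (k := l) (A := l ⊗[k] quadricCoordRing q)
    (B := quadricCoordRing (extendQF q l)) (quadricCoordRingBaseChange q l)
  obtain ⟨e₂⟩ := nonempty_fractionRing_tensor_algEquiv (k := k) l (quadricCoordRing q)
  obtain ⟨e₃⟩ := nonempty_fractionRing_algEquiv (k := l)
    (A := l ⊗[k] quadricFunctionField q) (B := l ⊗[k] quadricFunctionField q')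
    (Algebra.TensorProduct.congr (AlgEquiv.refl : l ≃ₐ[l] l) e)
  obtain ⟨e₄⟩ := nonempty_fractionRing_tensor_algEquiv (k := k) l (quadricCoordRing q')
  obtain ⟨e₅⟩ := nonempty_fractionRing_algEquiv (k := l) (A := l ⊗[k] quadricCoordRing q')
    (B := quadricCoordRing (extendQF q' l)) (quadricCoordRingBaseChange q' l)
  exact ⟨e₁.symm.trans <| e₂.trans <| e₃.trans <| e₄.symm.trans e₅⟩

theorem SplitsIn.of_algEquiv {k : Type*} [Field k] {A : Type*} [Ring A] [Algebra k A]
    {K L : Type*} [CommRing K] [Algebra k K] [CommRing L] [Algebra k L] (e : K ≃ₐ[k] L)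
    (h : SplitsIn k A K) : SplitsIn k A L := by
  obtain ⟨n, hn, ⟨f⟩⟩ := h
  refine ⟨n, hn, ⟨AlgEquiv.ofRingEquiv (f := ((Algebra.TensorProduct.congr e.symm
    (AlgEquiv.refl : A ≃ₐ[k] A)).toRingEquiv.trans f.toRingEquiv).trans
      e.toRingEquiv.mapMatrix) fun x => ?_⟩⟩
  have h1 : Algebra.TensorProduct.congr e.symm (AlgEquiv.refl : A ≃ₐ[k] A)
      (algebraMap L (L ⊗[k] A) x) = algebraMap K _ (e.symm x) := by
    simp [Algebra.TensorProduct.algebraMap_apply]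
  change e.toRingEquiv.mapMatrix (f (Algebra.TensorProduct.congr e.symm
      (AlgEquiv.refl : A ≃ₐ[k] A) (algebraMap L (L ⊗[k] A) x))) = _
  rw [h1, f.commutes]
  ext i j
  simp [Matrix.algebraMap_matrix_apply, apply_ite e]

theorem splitsIn_congr {k : Type*} [Field k] {A : Type*} [Ring A] [Algebra k A]
    {K L : Type*} [CommRing K] [Algebra k K] [CommRing L] [Algebra k L]
    (e : Nonempty (K ≃ₐ[k] L)) : SplitsIn k A K ↔ SplitsIn k A L :=
  ⟨.of_algEquiv e.some, .of_algEquiv e.some.symm⟩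

theorem two_ne_zero_of_algebra (k : Type*) {K : Type*} [Field k] [CommRing K] [Nontrivial K]
    [Algebra k K] (h2 : (2 : k) ≠ 0) : (2 : K) ≠ 0 := by
  rw [← map_ofNat (algebraMap k K) 2]
  exact (map_ne_zero_iff _ (algebraMap k K).injective).mpr h2

/-! ### Quaternion algebras -/

theorem isCentral_quaternionAlgebra {k : Type*} [Field k] (h2 : (2 : k) ≠ 0) {a b : k}
    (ha : a ≠ 0) : Algebra.IsCentral k ℍ[k,a,b] := by
  refine ⟨fun x hx => ?_⟩
  have hi := Subalgebra.mem_center_iff.mp hx ⟨0, 1, 0, 0⟩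
  have hj := Subalgebra.mem_center_iff.mp hx ⟨0, 0, 1, 0⟩
  have zero {y : k} (h : y = -y) : y = 0 := by
    have : 2 * y = 0 := by linear_combination h
    simpa [h2] using this
  have hI : x.imI = 0 := by
    have := congrArg QuaternionAlgebra.imK hj
    simp at this
    exact zero this.symm
  have hJ : x.imJ = 0 := by
    have := congrArg QuaternionAlgebra.imK hi
    simp at this
    exact zero this
  have hK : x.imK = 0 := by
    have := congrArg QuaternionAlgebra.imJ hi
    simp at this
    have : a * x.imK = 0 := zero (by linear_combination this)
    simpa [ha] using this
  refine Algebra.mem_bot.mpr ⟨x.re, ?_⟩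
  ext <;> simp [hI, hJ, hK]

theorem isSimpleRing_quaternionAlgebra {k : Type*} [Field k] (h2 : (2 : k) ≠ 0) {a b : k}
    (ha : a ≠ 0) (hb : b ≠ 0) : IsSimpleRing ℍ[k,a,b] := by
  refine ⟨⟨fun I => or_iff_not_imp_left.mpr fun hI => ?_⟩⟩
  obtain ⟨x, hx, hx0⟩ : ∃ x ∈ I, x ≠ 0 := by
    by_contra! h
    exact hI (eq_bot_iff.mpr fun x hx => (TwoSidedIdeal.mem_bot _).mpr (h x hx))
  have smul (r : k) {y : ℍ[k,a,b]} (hy : y ∈ I) : r • y ∈ I := by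
    rw [← QuaternionAlgebra.coe_mul_eq_smul]
    exact I.mul_mem_left _ _ hy
  have split (y : ℍ[k,a,b]) (hy : y ∈ I) :
      (⟨y.re, y.imI, 0, 0⟩ : ℍ[k,a,b]) ∈ I ∧ (⟨0, 0, y.imJ, y.imK⟩ : ℍ[k,a,b]) ∈ I := by
    have hc : a⁻¹ • ((⟨0, 1, 0, 0⟩ : ℍ[k,a,b]) * y * ⟨0, 1, 0, 0⟩) ∈ I :=
      smul _ (I.mul_mem_right _ _ (I.mul_mem_left _ _ hy))
    constructor
    · convert smul 2⁻¹ (I.add_mem hy hc) using 1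
      ext <;> simp <;> field_simp <;> simp [← two_mul, mul_comm]
    · convert smul 2⁻¹ (I.sub_mem hy hc) using 1
      ext <;> simp <;> field_simp <;> simp [← two_mul, mul_comm]
  have split' (y : ℍ[k,a,b]) (hy : y ∈ I) :
      (⟨y.re, 0, y.imJ, 0⟩ : ℍ[k,a,b]) ∈ I ∧ (⟨0, y.imI, 0, y.imK⟩ : ℍ[k,a,b]) ∈ I := by
    have hc : b⁻¹ • ((⟨0, 0, 1, 0⟩ : ℍ[k,a,b]) * y * ⟨0, 0, 1, 0⟩) ∈ I :=
      smul _ (I.mul_mem_right _ _ (I.mul_mem_left _ _ hy))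
    constructor
    · convert smul 2⁻¹ (I.add_mem hy hc) using 1
      ext <;> simp <;> field_simp <;> simp [← two_mul, mul_comm]
    · convert smul 2⁻¹ (I.sub_mem hy hc) using 1
      ext <;> simp <;> field_simp <;> simp [← two_mul, mul_comm]
  have top {y : ℍ[k,a,b]} (z : ℍ[k,a,b]) (h : z * y = 1) (hy : y ∈ I) : I = ⊤ := by
    rw [← TwoSidedIdeal.one_mem_iff, ← h]
    exact I.mul_mem_left _ _ hy
  have h1 := split' _ (split x hx).1
  have h3 := split' _ (split x hx).2
  by_cases hr : x.re = 0
  · by_cases hs : x.imI = 0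
    · by_cases ht : x.imJ = 0
      · have hu : x.imK ≠ 0 := fun hu => hx0 (by ext <;> simpa)
        refine top ⟨0, 0, 0, -(a * b * x.imK)⁻¹⟩ ?_ h3.2
        ext <;> simp
        field_simp
      · refine top ⟨0, 0, (b * x.imJ)⁻¹, 0⟩ ?_ h3.1
        ext <;> simp
        field_simp
    · refine top ⟨0, (a * x.imI)⁻¹, 0, 0⟩ ?_ h1.2
      ext <;> simp
      field_simp
  · refine top ⟨x.re⁻¹, 0, 0, 0⟩ ?_ h1.1
    ext <;> simp [hr]

/-- The quaternion algebra homomorphism induced by an extension of scalars. -/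
theorem nonempty_tensor_quaternionAlgebra_algEquiv {k : Type*} [Field k] (a b : k) (K : Type*)
    [Field K] [Algebra k K] :
    Nonempty (K ⊗[k] ℍ[k,a,b] ≃ₐ[K] ℍ[K,algebraMap k K a,algebraMap k K b]) := by
  have hal (c : k) : algebraMap k ℍ[K,algebraMap k K a,algebraMap k K b] c =
      ⟨algebraMap k K c, 0, 0, 0⟩ := rfl
  let B : QuaternionAlgebra.Basis ℍ[K,algebraMap k K a,algebraMap k K b] a 0 b :=
    { i := ⟨0, 1, 0, 0⟩
      j := ⟨0, 0, 1, 0⟩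
      k := ⟨0, 0, 0, 1⟩
      i_mul_i := by ext <;> simp [Algebra.smul_def, hal]
      j_mul_j := by ext <;> simp [Algebra.smul_def, hal]
      i_mul_j := by ext <;> simp
      j_mul_i := by ext <;> simp }
  let f : K ⊗[k] ℍ[k,a,b] →ₐ[K] ℍ[K,algebraMap k K a,algebraMap k K b] :=
    Algebra.TensorProduct.lift (Algebra.ofId K _) B.liftHom (fun x y => Algebra.commutes x _)
  have hsurj : Function.Surjective f := by
    intro x
    have hf (r : K) (y : ℍ[k,a,b]) : f (r ⊗ₜ y) = r • B.lift y := by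
      rw [Algebra.smul_def]
      exact Algebra.TensorProduct.lift_tmul _ _ _ _ _
    refine ⟨x.re ⊗ₜ ⟨1, 0, 0, 0⟩ + x.imI ⊗ₜ ⟨0, 1, 0, 0⟩ + x.imJ ⊗ₜ ⟨0, 0, 1, 0⟩ +
      x.imK ⊗ₜ ⟨0, 0, 0, 1⟩, ?_⟩
    simp only [map_add, hf]
    ext <;> simp [QuaternionAlgebra.Basis.lift, B]
  have hrank : Module.finrank K (K ⊗[k] ℍ[k,a,b]) =
      Module.finrank K ℍ[K,algebraMap k K a,algebraMap k K b] := by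
    rw [Module.finrank_baseChange, QuaternionAlgebra.finrank_eq_four,
      QuaternionAlgebra.finrank_eq_four]
  exact ⟨AlgEquiv.ofBijective f
    ⟨(LinearMap.injective_iff_surjective_of_finrank_eq_finrank hrank
      (f := f.toLinearMap)).mpr hsurj, hsurj⟩⟩

/-- The norm form of the quaternion algebra `(a, b)` is isotropic over `K`. -/
def NormIsotropic {K : Type*} [CommRing K] (a b : K) : Prop :=
  ∃ x : Fin 4 → K, x ≠ 0 ∧ x 0 ^ 2 - a * x 1 ^ 2 - b * x 2 ^ 2 + a * b * x 3 ^ 2 = 0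

theorem normIsotropic_of_splitsIn {k : Type*} [Field k] {a b : k} {K : Type*} [Field K]
    [Algebra k K] (h : SplitsIn k ℍ[k,a,b] K) :
    NormIsotropic (algebraMap k K a) (algebraMap k K b) := by
  obtain ⟨n, hn, ⟨e⟩⟩ := h
  obtain ⟨e'⟩ := nonempty_tensor_quaternionAlgebra_algEquiv a b K
  let f := e'.symm.trans e
  have hrank := f.toLinearEquiv.finrank_eq
  rw [QuaternionAlgebra.finrank_eq_four, Module.finrank_matrix] at hrank
  obtain rfl : n = 2 := by
    simp at hrank
    have : n ≤ 4 := by nlinarith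
    interval_cases n <;> omega
  let x := f.symm !![0, 1; 0, 0]
  have hx0 : x ≠ 0 := by
    intro h
    have := congrArg f h
    rw [map_zero, AlgEquiv.apply_symm_apply] at this
    simpa using congrFun (congrFun this 0) 1
  have hxx : x * x = 0 := by
    rw [← map_mul]
    convert map_zero f.symm
    ext i j
    fin_cases i <;> fin_cases j <;> simp
  refine ⟨![x.re, x.imI, x.imJ, x.imK], ?_, ?_⟩
  · intro h
    refine hx0 (QuaternionAlgebra.ext ?_ ?_ ?_ ?_)
    · simpa using congrFun h 0
    · simpa using congrFun h 1
    · simpa using congrFun h 2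
    · simpa using congrFun h 3
  · by_contra hN
    simp only [Matrix.cons_val_zero, Matrix.cons_val_one, Matrix.cons_val] at hN
    set N : K := x.re ^ 2 - algebraMap k K a * x.imI ^ 2 - algebraMap k K b * x.imJ ^ 2 +
      algebraMap k K a * algebraMap k K b * x.imK ^ 2 with hNdef
    have hs : star x * x = (N : ℍ[K,algebraMap k K a,algebraMap k K b]) := by
      rw [QuaternionAlgebra.star_mul_eq_coe, QuaternionAlgebra.coe_inj]
      simp
      ring
    have : N • x = 0 := by
      rw [← QuaternionAlgebra.coe_mul_eq_smul, ← hs, mul_assoc, hxx, mul_zero]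
    exact hx0 ((smul_eq_zero.mp this).resolve_left hN)

theorem NormIsotropic.exists_eq {K : Type*} [Field K] (h2 : (2 : K) ≠ 0) {a b : K} (ha : a ≠ 0)
    (h : NormIsotropic a b) : ∃ u v, b = u ^ 2 - a * v ^ 2 := by
  obtain ⟨x, hx0, hx⟩ := h
  by_cases hm : x 2 ^ 2 - a * x 3 ^ 2 = 0
  · obtain ⟨ρ, hρ⟩ : ∃ ρ, a = ρ ^ 2 := by
      by_cases h3 : x 3 = 0
      · have h2' : x 2 = 0 := by simpa [h3] using hm
        have h1 : x 1 ≠ 0 := by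
          intro h1
          have h0 : x 0 = 0 := by simpa [h1, h2', h3] using hx
          exact hx0 (by ext i; fin_cases i <;> assumption)
        refine ⟨x 0 / x 1, ?_⟩
        field_simp
        rw [h2', h3] at hx
        linear_combination -hx
      · refine ⟨x 2 / x 3, ?_⟩
        field_simp
        linear_combination -hm
    have hρ0 : ρ ≠ 0 := by
      rintro rfl
      simp [ha] at hρ
    refine ⟨(b + 1) / 2, (b - 1) / (2 * ρ), ?_⟩
    rw [hρ]
    field_simp
    ring
  · refine ⟨(x 0 * x 2 - a * x 1 * x 3) / (x 2 ^ 2 - a * x 3 ^ 2),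
      (x 1 * x 2 - x 0 * x 3) / (x 2 ^ 2 - a * x 3 ^ 2), ?_⟩
    field_simp
    linear_combination -(x 2 ^ 2 - a * x 3 ^ 2) * hx

theorem splitsIn_of_normIsotropic {k : Type*} [Field k] (h2 : (2 : k) ≠ 0) {a b : k}
    (ha : a ≠ 0) (hb : b ≠ 0) {K : Type*} [Field K] [Algebra k K]
    (h : NormIsotropic (algebraMap k K a) (algebraMap k K b)) : SplitsIn k ℍ[k,a,b] K := by
  have hinj := (algebraMap k K).injective
  have h2K : (2 : K) ≠ 0 := two_ne_zero_of_algebra k h2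
  have haK := (map_ne_zero_iff _ hinj).mpr ha
  have hbK := (map_ne_zero_iff _ hinj).mpr hb
  obtain ⟨u, v, huv⟩ := h.exists_eq h2K haK
  obtain ⟨e⟩ := nonempty_tensor_quaternionAlgebra_algEquiv a b K
  set a' := algebraMap k K a
  set b' := algebraMap k K b
  let B : QuaternionAlgebra.Basis (Matrix (Fin 2) (Fin 2) K) a' 0 b' :=
    { i := !![0, a'; 1, 0]
      j := !![u, -(a' * v); v, -u]
      k := !![0, a'; 1, 0] * !![u, -(a' * v); v, -u]
      i_mul_i := by
        ext i j
        fin_cases i <;> fin_cases j <;> simp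
      j_mul_j := by
        rw [huv]
        ext i j
        fin_cases i <;> fin_cases j <;> simp <;> ring
      i_mul_j := rfl
      j_mul_i := by
        ext i j
        fin_cases i <;> fin_cases j <;> simp <;> ring }
  have := isSimpleRing_quaternionAlgebra h2K haK hbK
  have hinjB : Function.Injective B.liftHom := B.liftHom.toRingHom.injective
  have hrank : Module.finrank K ℍ[K,a',b'] = Module.finrank K (Matrix (Fin 2) (Fin 2) K) := by
    rw [QuaternionAlgebra.finrank_eq_four, Module.finrank_matrix]
    simp
  have hsurj := (LinearMap.injective_iff_surjective_of_finrank_eq_finrank hrank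
    (f := B.liftHom.toLinearMap)).mp hinjB
  exact ⟨2, two_pos, ⟨e.trans (AlgEquiv.ofBijective _ ⟨hinjB, hsurj⟩)⟩⟩

/-! ### Change of variables and diagonalisation -/

theorem polar_eq_dotProduct {k : Type*} [CommRing k] {n : ℕ} (q : QuadraticForm k (Fin n → k))
    (x y : Fin n → k) : QuadraticMap.polar q x y = x ⬝ᵥ (polarMatrix q).mulVec y := by
  rw [← QuadraticMap.polarBilin_apply_apply, ← Matrix.toLinearMap₂'_toMatrix' (R := k)
    (QuadraticMap.polarBilin q), Matrix.toLinearMap₂'_apply']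
  congr 2

theorem polarMatrix_mulVec {k : Type*} [CommRing k] {n : ℕ} {q q' : QuadraticForm k (Fin n → k)}
    {M : Matrix (Fin n) (Fin n) k} {c : k} (h : ∀ x, q' (M.mulVec x) = c * q x) :
    c • polarMatrix q = M.transpose * polarMatrix q' * M := by
  ext i j
  have e (i j) : (M.transpose * polarMatrix q' * M) i j =
      QuadraticMap.polar q' (M.mulVec (Pi.single i 1)) (M.mulVec (Pi.single j 1)) := by
    rw [polar_eq_dotProduct, ← Matrix.vecMul_transpose, ← Matrix.dotProduct_mulVec,
      Matrix.mulVec_mulVec, Matrix.mulVec_mulVec]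
    simp [mul_assoc]
  rw [e]
  simp only [QuadraticMap.polar, ← Matrix.mulVec_add, h, Matrix.smul_apply, polarMatrix,
    Matrix.of_apply, smul_eq_mul]
  ring

theorem NondegQF.of_mulVec {k : Type*} [Field k] {n : ℕ} {q q' : QuadraticForm k (Fin n → k)}
    (hq : NondegQF q') {M : Matrix (Fin n) (Fin n) k} (hM : M.det ≠ 0) {c : k}
    (h : ∀ x, q' (M.mulVec x) = c * q x) : NondegQF q := by
  have := congrArg Matrix.det (polarMatrix_mulVec h)
  rw [Matrix.det_smul, Matrix.det_mul, Matrix.det_mul, Matrix.det_transpose] at this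
  exact right_ne_zero_of_mul (this.trans_ne (mul_ne_zero (mul_ne_zero hM hq) hM))

theorem NondegQF.eq_zero_of_polar {k : Type*} [Field k] {n : ℕ} {q : QuadraticForm k (Fin n → k)}
    (hq : NondegQF q) {x : Fin n → k} (h : ∀ y, QuadraticMap.polar q y x = 0) : x = 0 := by
  refine Matrix.eq_zero_of_mulVec_eq_zero hq (funext fun i => ?_)
  have := h (Pi.single i 1)
  rw [polar_eq_dotProduct] at this
  simpa using this

/-- The diagonal form `⟨1, -a, -b, -c⟩`. -/
def diagQF {k : Type*} [CommRing k] (a b c : k) : QuadraticForm k (Fin 4 → k) :=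
  QuadraticMap.weightedSumSquares k ![1, -a, -b, -c]

theorem diagQF_apply {k : Type*} [CommRing k] (a b c : k) (x : Fin 4 → k) :
    diagQF a b c x = x 0 ^ 2 - a * x 1 ^ 2 - b * x 2 ^ 2 - c * x 3 ^ 2 := by
  simp [diagQF, QuadraticMap.weightedSumSquares_apply, Fin.sum_univ_four]
  ring

theorem extendQF_diagQF {k : Type*} [CommRing k] (a b c : k) (S : Type*) [CommRing S]
    [Algebra k S] :
    extendQF (diagQF a b c) S = diagQF (algebraMap k S a) (algebraMap k S b) (algebraMap k S c) := by
  refine quadraticForm_ext_of_algebraMap (R := k) fun x => ?_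
  rw [extendQF_algebraMap, diagQF_apply, diagQF_apply]
  simp

theorem nondegQF_diagQF {k : Type*} [Field k] (h2 : (2 : k) ≠ 0) {a b c : k} (ha : a ≠ 0)
    (hb : b ≠ 0) (hc : c ≠ 0) : NondegQF (diagQF a b c) := by
  have : polarMatrix (diagQF a b c) = Matrix.diagonal ![2, -2 * a, -2 * b, -2 * c] := by
    ext i j
    fin_cases i <;> fin_cases j <;>
      simp [polarMatrix, QuadraticMap.polar, diagQF_apply] <;> ring
  rw [NondegQF, discQF, this, Matrix.det_diagonal]
  simp [Fin.prod_univ_four, h2, ha, hb, hc]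

theorem exists_diagQF_mulVec {k : Type*} [Field k] (h2 : (2 : k) ≠ 0)
    {q : QuadraticForm k (Fin 4 → k)} (hq : NondegQF q) :
    ∃ a b c : k, a ≠ 0 ∧ b ≠ 0 ∧ c ≠ 0 ∧ ∃ (M : Matrix (Fin 4) (Fin 4) k) (r : k),
      M.det ≠ 0 ∧ r ≠ 0 ∧ ∀ x, diagQF a b c (M.mulVec x) = r * q x := by
  let := invertibleOfNonzero h2
  have hsep : (QuadraticMap.associated (R := k) q).SeparatingLeft := by
    intro x hx
    refine hq.eq_zero_of_polar fun y => ?_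
    rw [QuadraticMap.polar_comm, ← QuadraticMap.polarBilin_apply_apply,
      ← QuadraticMap.two_nsmul_associated k, LinearMap.smul_apply, LinearMap.smul_apply, hx,
      smul_zero]
  have := QuadraticForm.equivalent_weightedSumSquares_units_of_nondegenerate' q hsep
  rw [Module.finrank_fin_fun] at this
  obtain ⟨w, ⟨e⟩⟩ := this
  have h0 := (w 0).ne_zero
  have h1 := (w 1).ne_zero
  have h2 := (w 2).ne_zero
  have h3 := (w 3).ne_zero
  refine ⟨-(w 1 / w 0), -(w 2 / w 0), -(w 3 / w 0), by simp, by simp, by simp,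
    LinearMap.toMatrix' e.toLinearEquiv.toLinearMap, (w 0 : k)⁻¹, ?_, by simp, fun x => ?_⟩
  · rw [LinearMap.det_toMatrix']
    exact (LinearEquiv.isUnit_det' e.toLinearEquiv).ne_zero
  · rw [← e.map_app x, LinearMap.toMatrix'_mulVec, diagQF_apply,
      QuadraticMap.weightedSumSquares_apply, Fin.sum_univ_four]
    simp only [Units.smul_def, smul_eq_mul]
    change (e x 0) ^ 2 - _ * (e x 1) ^ 2 - _ * (e x 2) ^ 2 - _ * (e x 3) ^ 2 = _
    field_simp
    ring

/-! ### Isotropic forms -/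

theorem exists_ne_zero_of_linearForms {k : Type*} [Field k] {m n : ℕ} (hmn : m < n)
    (f : Fin m → (Fin n → k) →ₗ[k] k) : ∃ x ≠ 0, ∀ i, f i x = 0 := by
  have h := LinearMap.ker_ne_bot_of_finrank_lt (f := LinearMap.pi f) (by simpa using hmn)
  obtain ⟨x, hx, hx0⟩ := Submodule.exists_mem_ne_zero_of_ne_bot h
  exact ⟨x, hx0, fun i => congrFun hx i⟩

/-- The form `x₂x₃ + αx₀² + βx₀x₁ + γx₁²`. -/
def hyperbolicQF {k : Type*} [CommRing k] (α β γ : k) : QuadraticForm k (Fin 4 → k) :=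
  Matrix.toQuadraticForm' !![α, β, 0, 0; 0, γ, 0, 0; 0, 0, 0, 1; 0, 0, 0, 0]

theorem hyperbolicQF_apply {k : Type*} [CommRing k] (α β γ : k) (x : Fin 4 → k) :
    hyperbolicQF α β γ x = x 2 * x 3 + α * x 0 ^ 2 + β * x 0 * x 1 + γ * x 1 ^ 2 := by
  change Matrix.toLinearMap₂' k _ x x = _
  rw [Matrix.toLinearMap₂'_apply]
  simp [Fin.sum_univ_four]
  ring

theorem extendQF_hyperbolicQF {k : Type*} [CommRing k] (α β γ : k) (S : Type*) [CommRing S]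
    [Algebra k S] : extendQF (hyperbolicQF α β γ) S =
      hyperbolicQF (algebraMap k S α) (algebraMap k S β) (algebraMap k S γ) := by
  refine quadraticForm_ext_of_algebraMap (R := k) fun x => ?_
  rw [extendQF_algebraMap, hyperbolicQF_apply, hyperbolicQF_apply]
  simp

theorem exists_hyperbolicQF_mulVec {k : Type*} [Field k] {q : QuadraticForm k (Fin 4 → k)}
    (hq : NondegQF q) {u : Fin 4 → k} (hu0 : u ≠ 0) (hu : q u = 0) :
    ∃ (α β γ : k) (M : Matrix (Fin 4) (Fin 4) k), M.det ≠ 0 ∧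
      ∀ x, q (M.mulVec x) = 1 * hyperbolicQF α β γ x := by
  have eq_add (x y : Fin 4 → k) : q (x + y) = q x + q y + QuadraticMap.polar q x y := by
    simp [QuadraticMap.polar]
  obtain ⟨w, huw, hw⟩ : ∃ w, QuadraticMap.polar q u w = 1 ∧ q w = 0 := by
    obtain ⟨w, hw⟩ : ∃ w, QuadraticMap.polar q w u ≠ 0 := by
      by_contra! h
      exact hu0 (hq.eq_zero_of_polar h)
    set p := QuadraticMap.polar q w u with hp
    have hpu : QuadraticMap.polar q u (p⁻¹ • w) = 1 := by
      rw [QuadraticMap.polar_smul_right, QuadraticMap.polar_comm, smul_eq_mul, ← hp,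
        inv_mul_cancel₀ hw]
    refine ⟨p⁻¹ • w - q (p⁻¹ • w) • u, ?_, ?_⟩
    · rw [QuadraticMap.polar_sub_right, hpu, QuadraticMap.polar_smul_right,
        QuadraticMap.polar_self, hu]
      simp
    · rw [sub_eq_add_neg, ← neg_smul, eq_add, QuadraticMap.map_smul q (-_), hu,
        QuadraticMap.polar_smul_right, QuadraticMap.polar_comm, hpu]
      simp
  let pu := QuadraticMap.polarBilin q u
  let pw := QuadraticMap.polarBilin q w
  obtain ⟨e, he0, he⟩ := exists_ne_zero_of_linearForms (k := k) (m := 2) (n := 4) (by norm_num)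
    ![pu, pw]
  obtain ⟨i, hi⟩ := Function.ne_iff.mp he0
  obtain ⟨f, hf0, hf⟩ := exists_ne_zero_of_linearForms (k := k) (m := 3) (n := 4) (by norm_num)
    ![pu, pw, LinearMap.proj i]
  have hue : QuadraticMap.polar q u e = 0 := he 0
  have hwe : QuadraticMap.polar q w e = 0 := he 1
  have huf : QuadraticMap.polar q u f = 0 := hf 0
  have hwf : QuadraticMap.polar q w f = 0 := hf 1
  have hif : f i = 0 := hf 2
  let M : Matrix (Fin 4) (Fin 4) k := (Matrix.of ![e, f, u, w]).transpose
  have hM (x : Fin 4 → k) : M.mulVec x = x 0 • e + x 1 • f + x 2 • u + x 3 • w := by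
    ext j
    simp [M, Matrix.mulVec, dotProduct, Fin.sum_univ_four, mul_comm]
  refine ⟨q e, QuadraticMap.polar q e f, q f, M, ?_, fun x => ?_⟩
  · intro hdet
    obtain ⟨x, hx0, hx⟩ := Matrix.exists_mulVec_eq_zero_iff.mpr hdet
    rw [hM] at hx
    have h3 : x 3 = 0 := by
      have := congrArg (QuadraticMap.polar q u) hx
      simpa [QuadraticMap.polar_add_right, QuadraticMap.polar_smul_right, hue, huf, huw, hu]
        using this
    have h2 : x 2 = 0 := by
      have := congrArg (QuadraticMap.polar q w) hx
      simpa [QuadraticMap.polar_add_right, QuadraticMap.polar_smul_right, hwe, hwf, hw,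
        QuadraticMap.polar_comm q w u, huw] using this
    have h0 : x 0 = 0 := by
      have := congrFun hx i
      simp [h2, h3, hif] at this
      exact this.resolve_right hi
    have h1 : x 1 = 0 := by
      simp only [h0, h2, h3, zero_smul, zero_add, add_zero] at hx
      exact (smul_eq_zero.mp hx).resolve_right hf0
    exact hx0 (by ext i; fin_cases i <;> assumption)
  · rw [hM, hyperbolicQF_apply, eq_add, eq_add, eq_add]
    simp only [QuadraticMap.map_smul, QuadraticMap.polar_add_left, QuadraticMap.polar_smul_left,
      QuadraticMap.polar_smul_right, hu, hw, huw, QuadraticMap.polar_comm q e u,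
      QuadraticMap.polar_comm q f u, QuadraticMap.polar_comm q e w, QuadraticMap.polar_comm q f w,
      hue, huf, hwe, hwf, smul_eq_mul]
    ring

theorem nonempty_quadricCoordRing_hyperbolicQF_algEquiv {k : Type*} [Field k]
    (α β γ α' β' γ' : k) : Nonempty (quadricCoordRing (hyperbolicQF α β γ) ≃ₐ[k]
      quadricCoordRing (hyperbolicQF α' β' γ')) := by
  have main (α β γ α' β' γ' : k) : ∃ f : quadricCoordRing (hyperbolicQF α β γ) →ₐ[k]
      quadricCoordRing (hyperbolicQF α' β' γ'),
      f (coordPoint _ 0) = coordPoint _ 0 ∧ f (coordPoint _ 1) = coordPoint _ 1 := by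
    let A := quadricCoordRing (hyperbolicQF α' β' γ')
    let v : Fin 4 → A := coordPoint (hyperbolicQF α' β' γ')
    let w : Fin 4 → A := ![v 0, v 1, -(algebraMap k A α * v 0 ^ 2 + algebraMap k A β * v 0 * v 1 +
      algebraMap k A γ * v 1 ^ 2), 1]
    have hw : extendQF (hyperbolicQF α β γ) A w = 0 := by
      rw [extendQF_hyperbolicQF, hyperbolicQF_apply]
      simp [w]
      ring
    have h1 (i : Fin 4) (hi : ¬ (i : ℕ) < 4 - 1) : w i = 1 := by
      obtain rfl : i = 3 := by omega
      rfl
    exact ⟨coordLift _ w hw h1, coordLift_coordPoint _ w hw h1 0, coordLift_coordPoint _ w hw h1 1⟩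
  have unique (α β γ : k) (f : quadricCoordRing (hyperbolicQF α β γ) →ₐ[k]
      quadricCoordRing (hyperbolicQF α β γ)) (h0 : f (coordPoint _ 0) = coordPoint _ 0)
      (h1 : f (coordPoint _ 1) = coordPoint _ 1) : f = AlgHom.id k _ := by
    refine quadricCoordRing_algHom_ext fun i => ?_
    have hv := extendQF_coordPoint (hyperbolicQF α β γ)
    have hl := coordPoint_last (hyperbolicQF α β γ) 3 (by decide)
    rw [extendQF_hyperbolicQF, hyperbolicQF_apply, hl, mul_one] at hv
    have hfv := congrArg f hv
    simp only [map_add, map_mul, map_pow, h0, h1, AlgHom.commutes, map_zero] at hfv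
    fin_cases i
    · exact h0
    · exact h1
    · change f (coordPoint _ 2) = coordPoint _ 2
      linear_combination hfv - hv
    · change f (coordPoint _ 3) = coordPoint _ 3
      rw [hl, map_one]
  obtain ⟨f, hf0, hf1⟩ := main α β γ α' β' γ'
  obtain ⟨g, hg0, hg1⟩ := main α' β' γ' α β γ
  exact ⟨AlgEquiv.ofAlgHom f g
    (unique _ _ _ _ (by rw [AlgHom.comp_apply, hg0, hf0]) (by rw [AlgHom.comp_apply, hg1, hf1]))
    (unique _ _ _ _ (by rw [AlgHom.comp_apply, hf0, hg0]) (by rw [AlgHom.comp_apply, hf1, hg1]))⟩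

theorem nonempty_functionField_algEquiv_of_isotropic {k : Type*} [Field k] (h2 : (2 : k) ≠ 0)
    {q q' : QuadraticForm k (Fin 4 → k)} (hq : NondegQF q) (hq' : NondegQF q')
    (h : ∃ u, u ≠ 0 ∧ q u = 0) (h' : ∃ u, u ≠ 0 ∧ q' u = 0) :
    Nonempty (quadricFunctionField q ≃ₐ[k] quadricFunctionField q') := by
  obtain ⟨u, hu0, hu⟩ := h
  obtain ⟨u', hu0', hu'⟩ := h'
  obtain ⟨α, β, γ, M, hM, h⟩ := exists_hyperbolicQF_mulVec hq hu0 hu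
  obtain ⟨α', β', γ', M', hM', h'⟩ := exists_hyperbolicQF_mulVec hq' hu0' hu'
  obtain ⟨e₁⟩ := nonempty_functionField_algEquiv_of_mulVec h2
    (hq.of_mulVec hM h) hq hM one_ne_zero h
  obtain ⟨e₂⟩ := nonempty_functionField_algEquiv_of_mulVec h2
    (hq'.of_mulVec hM' h') hq' hM' one_ne_zero h'
  obtain ⟨e₃⟩ := nonempty_fractionRing_algEquiv
    (nonempty_quadricCoordRing_hyperbolicQF_algEquiv α β γ α' β' γ').some
  exact ⟨e₁.symm.trans <| e₃.trans e₂⟩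

/-! ### Ternary diagonal forms over polynomial rings -/

/-- The bilinear form of the diagonal form `⟨w₀, w₁, w₂⟩`. -/
def ternaryForm {R : Type*} [CommRing R] (w x y : Fin 3 → R) : R :=
  w 0 * x 0 * y 0 + w 1 * x 1 * y 1 + w 2 * x 2 * y 2

/-- The diagonal form `⟨w₀, w₁, w₂⟩` has no nontrivial zero. -/
def TernaryAnisotropic {R : Type*} [CommRing R] (w : Fin 3 → R) : Prop :=
  ∀ x, ternaryForm w x x = 0 → x = 0

theorem map_ternaryForm {R S : Type*} [CommRing R] [CommRing S] (f : R →+* S) (w x y : Fin 3 → R) :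
    f (ternaryForm w x y) = ternaryForm (fun i => f (w i)) (fun i => f (x i)) fun i => f (y i) := by
  simp [ternaryForm]

theorem coeff_ternaryForm {F : Type*} [Field F] (w : Fin 3 → F) {P Q : Fin 3 → Polynomial F}
    {m n : ℕ} (hP : ∀ i, (P i).natDegree ≤ m) (hQ : ∀ i, (Q i).natDegree ≤ n) :
    (ternaryForm (fun i => Polynomial.C (w i)) P Q).coeff (m + n) =
      ternaryForm w (fun i => (P i).coeff m) fun i => (Q i).coeff n := by
  simp only [ternaryForm, mul_assoc, Polynomial.coeff_add, Polynomial.coeff_C_mul]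
  rw [Polynomial.coeff_mul_add_eq_of_natDegree_le (hP 0) (hQ 0),
    Polynomial.coeff_mul_add_eq_of_natDegree_le (hP 1) (hQ 1),
    Polynomial.coeff_mul_add_eq_of_natDegree_le (hP 2) (hQ 2)]

theorem natDegree_ternaryForm_le {F : Type*} [Field F] (w : Fin 3 → F)
    {P Q : Fin 3 → Polynomial F}
    {m n : ℕ} (hP : ∀ i, (P i).natDegree ≤ m) (hQ : ∀ i, (Q i).natDegree ≤ n) :
    (ternaryForm (fun i => Polynomial.C (w i)) P Q).natDegree ≤ m + n := by
  have h (i) : (Polynomial.C (w i) * P i * Q i).natDegree ≤ m + n := by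
    rw [mul_assoc]
    refine (Polynomial.natDegree_C_mul_le _ _).trans (Polynomial.natDegree_mul_le.trans ?_)
    have := hP i
    have := hQ i
    omega
  exact Polynomial.natDegree_add_le_of_degree_le
    (Polynomial.natDegree_add_le_of_degree_le (h 0) (h 1)) (h 2)

theorem TernaryAnisotropic.natDegree_le {F : Type*} [Field F] {w : Fin 3 → F}
    (hw : TernaryAnisotropic w) {P : Fin 3 → Polynomial F} {m : ℕ}
    (h : (ternaryForm (fun i => Polynomial.C (w i)) P P).natDegree ≤ 2 * m) (i : Fin 3) :
    (P i).natDegree ≤ m := by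
  by_contra! hi
  obtain ⟨j, hj⟩ := Finite.exists_max fun i => (P i).natDegree
  have hmj := hi.trans_le (hj i)
  have := hw _ ((coeff_ternaryForm w hj hj).symm.trans
    (Polynomial.coeff_eq_zero_of_natDegree_lt (by omega)))
  have h0 : P j = 0 := Polynomial.leadingCoeff_eq_zero.mp (congrFun this j)
  simp [h0] at hmj

theorem TernaryAnisotropic.polynomial {F : Type*} [Field F] {w : Fin 3 → F}
    (hw : TernaryAnisotropic w) :
    TernaryAnisotropic fun i => (Polynomial.C (w i) : Polynomial F) := by
  intro P hP
  have hd := hw.natDegree_le (P := P) (m := 0) (by simp [hP])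
  have h0 := hw _ ((coeff_ternaryForm w hd hd).symm.trans (by simp [hP]))
  ext1 i
  rw [Polynomial.eq_C_of_natDegree_le_zero (hd i), show (P i).coeff 0 = 0 from congrFun h0 i]
  simp

theorem exists_ternaryForm_eq_of_polynomial {F : Type*} [Field F] (h2 : (2 : F) ≠ 0)
    {w : Fin 3 → F} (hw : TernaryAnisotropic w) (β : Fin 3 → F) (s t : F)
    (P : Fin 3 → Polynomial F) (g : Polynomial F) (hg : g ≠ 0)
    (h : ternaryForm (fun i => Polynomial.C (w i)) P P =
      (Polynomial.C s + Polynomial.C t * Polynomial.X ^ 2) * g ^ 2)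
    (hβ : ternaryForm (fun i => Polynomial.C (w i)) P (fun i => Polynomial.C (β i)) = 0) :
    ∃ u v : Fin 3 → F, ternaryForm w u u = s ∧ ternaryForm w v v = t ∧ ternaryForm w u v = 0 ∧
      ternaryForm w u β = 0 ∧ ternaryForm w v β = 0 := by
  induction hn : g.natDegree using Nat.strong_induction_on generalizing P g with
  | _ n ih =>
  set W : Fin 3 → Polynomial F := fun i => Polynomial.C (w i) with hW
  set B : Fin 3 → Polynomial F := fun i => Polynomial.C (β i) with hB
  set f : Polynomial F := Polynomial.C s + Polynomial.C t * Polynomial.X ^ 2 with hf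
  set V : Fin 3 → Polynomial F := fun i => P i / g with hV
  set r : Fin 3 → Polynomial F := fun i => P i % g with hr
  have hdiv (i) : P i = g * V i + r i := (EuclideanDomain.div_add_mod _ _).symm
  by_cases hr0 : ∀ i, r i = 0
  · have hPV (i) : P i = g * V i := by rw [hdiv, hr0, add_zero]
    have hVV : ternaryForm W V V = f := by
      refine mul_left_cancel₀ (pow_ne_zero 2 hg) ?_
      rw [mul_comm _ f, ← h]
      simp only [ternaryForm, hPV]
      ring
    have hVB : ternaryForm W V B = 0 := by
      refine mul_left_cancel₀ hg ?_
      rw [mul_zero, ← hβ]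
      simp only [ternaryForm, hPV]
      ring
    have hd : ∀ i, (V i).natDegree ≤ 1 := hw.natDegree_le (by
      rw [hVV, hf]
      compute_degree)
    have hlin (i) : V i = Polynomial.C ((V i).coeff 1) * Polynomial.X +
        Polynomial.C ((V i).coeff 0) := Polynomial.eq_X_add_C_of_natDegree_le_one (hd i)
    have key : ternaryForm W V V =
        Polynomial.C (ternaryForm w (fun i => (V i).coeff 0) fun i => (V i).coeff 0) +
        Polynomial.C (2 * ternaryForm w (fun i => (V i).coeff 0) fun i => (V i).coeff 1) *
          Polynomial.X +
        Polynomial.C (ternaryForm w (fun i => (V i).coeff 1) fun i => (V i).coeff 1) *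
          Polynomial.X ^ 2 := by
      conv_lhs => rw [show V = _ from funext hlin]
      simp only [ternaryForm, hW, map_add, map_mul]
      simp only [map_ofNat]
      ring
    have keyB : ternaryForm W V B =
        Polynomial.C (ternaryForm w (fun i => (V i).coeff 0) β) +
        Polynomial.C (ternaryForm w (fun i => (V i).coeff 1) β) * Polynomial.X := by
      conv_lhs => rw [show V = _ from funext hlin]
      simp only [ternaryForm, hW, hB, map_add, map_mul]
      ring
    rw [hVV, hf] at key
    rw [hVB] at keyB
    refine ⟨fun i => (V i).coeff 0, fun i => (V i).coeff 1, ?_, ?_, ?_, ?_, ?_⟩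
    · simpa [Polynomial.coeff_X, Polynomial.coeff_C] using
        (congrArg (Polynomial.coeff · 0) key).symm
    · simpa [Polynomial.coeff_X, Polynomial.coeff_C, -map_mul, -map_add] using
        (congrArg (Polynomial.coeff · 2) key).symm
    · have := congrArg (Polynomial.coeff · 1) key
      simpa [Polynomial.coeff_X, Polynomial.coeff_C, -map_mul, -map_add, h2] using this.symm
    · simpa using (congrArg (Polynomial.coeff · 0) keyB).symm
    · simpa [Polynomial.coeff_C] using (congrArg (Polynomial.coeff · 1) keyB).symm
  · have hg0 : g.natDegree ≠ 0 := by
      intro h0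
      refine hr0 fun i => EuclideanDomain.mod_eq_zero.mpr ?_
      exact (Polynomial.isUnit_iff_degree_eq_zero.mpr
        ((Polynomial.degree_eq_iff_natDegree_eq hg).mpr h0)).dvd
    have hrd (i) : (r i).natDegree ≤ g.natDegree - 1 :=
      Nat.le_sub_one_of_lt (Polynomial.natDegree_mod_lt _ hg0)
    have hVB : ternaryForm W V B = 0 := by
      have e : g * ternaryForm W V B = - ternaryForm W r B := by
        rw [eq_neg_iff_add_eq_zero, ← hβ]
        simp only [ternaryForm, hdiv]
        ring
      have hd : (ternaryForm W r B).natDegree ≤ g.natDegree - 1 + 0 :=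
        natDegree_ternaryForm_le w hrd fun i => (Polynomial.natDegree_C _).le
      have := Polynomial.eq_zero_of_dvd_of_natDegree_lt (Dvd.intro _ e)
        (by rw [Polynomial.natDegree_neg]; omega)
      rw [this] at e
      exact (mul_eq_zero.mp e).resolve_left hg
    let g' := g * ternaryForm W V V - 2 * ternaryForm W P V + g * f
    have hgg : g * g' = ternaryForm W r r := by
      have hr' : r = fun i => P i - g * V i := funext fun i => eq_sub_of_add_eq' (hdiv i).symm
      simp only [hr', g']
      simp only [ternaryForm] at h ⊢
      linear_combination -h
    have hg' : g' ≠ 0 := by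
      rintro h0
      rw [h0, mul_zero] at hgg
      exact hr0 (congrFun (hw.polynomial _ hgg.symm))
    have hlt : g'.natDegree < n := by
      have h1 := Polynomial.natDegree_mul hg hg'
      rw [hgg] at h1
      have : (ternaryForm W r r).natDegree ≤ _ := natDegree_ternaryForm_le w hrd hrd
      omega
    refine ih _ hlt (fun i => (ternaryForm W V V - f) * P i -
      2 * (ternaryForm W P V - f * g) * V i) g' hg' ?_ ?_ rfl
    · simp only [g']
      simp only [ternaryForm] at h ⊢
      linear_combination (W 0 * V 0 * V 0 + W 1 * V 1 * V 1 + W 2 * V 2 * V 2 - f) ^ 2 * h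
    · have e : ternaryForm W (fun i => (ternaryForm W V V - f) * P i -
        2 * (ternaryForm W P V - f * g) * V i) B = (ternaryForm W V V - f) * ternaryForm W P B -
          2 * (ternaryForm W P V - f * g) * ternaryForm W V B := by
        simp only [ternaryForm]
        ring
      rw [e, hβ, hVB]
      ring

/-! ### Zeros of quaternion norm forms over function fields of quadrics -/

theorem exists_injective_quadricCoordRing_diagQF {l R : Type*} [Field l] [CommRing R] [Algebra l R]
    {a b c : l} {x y e : R} (he : e = algebraMap l R c + algebraMap l R a * x ^ 2 +
      algebraMap l R b * y ^ 2) (ψ : R →ₐ[l] quadricCoordRing (diagQF a b c))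
    (hx : ψ x = coordPoint _ 1) (hy : ψ y = coordPoint _ 2) :
    ∃ f : quadricCoordRing (diagQF a b c) →ₐ[l] QuadraticAlgebra R e 0, Function.Injective f := by
  have hl := coordPoint_last (diagQF a b c) 3 (by decide)
  have hv := extendQF_coordPoint (diagQF a b c)
  rw [extendQF_diagQF, diagQF_apply, hl, one_pow, mul_one] at hv
  have halg (s : l) : algebraMap l (QuadraticAlgebra R e 0) s = ⟨algebraMap l R s, 0⟩ := rfl
  have hψe : ψ e = coordPoint _ 0 ^ 2 := by
    rw [he]
    simp only [map_add, map_mul, map_pow, AlgHom.commutes, hx, hy]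
    linear_combination -hv
  let w : Fin 4 → QuadraticAlgebra R e 0 := ![⟨0, 1⟩, ⟨x, 0⟩, ⟨y, 0⟩, 1]
  have hw : extendQF (diagQF a b c) (QuadraticAlgebra R e 0) w = 0 := by
    rw [extendQF_diagQF, diagQF_apply, halg, halg, halg]
    refine QuadraticAlgebra.ext ?_ ?_
    · simp [w, pow_two]
      rw [he]
      ring
    · simp [w, pow_two]
  have hw1 (i : Fin 4) (hi : ¬ (i : ℕ) < 4 - 1) : w i = 1 := by
    obtain rfl : i = 3 := by omega
    rfl
  let θ : QuadraticAlgebra R e 0 →ₐ[l] quadricCoordRing (diagQF a b c) :=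
    { toFun := fun t => ψ t.re + ψ t.im * coordPoint _ 0
      map_one' := by simp [QuadraticAlgebra.re_one, QuadraticAlgebra.im_one]
      map_zero' := by simp
      map_add' := fun s t => by
        simp
        ring
      map_mul' := fun s t => by
        simp [hψe]
        ring
      commutes' := fun s => by simp [halg] }
  have hid : θ.comp (coordLift _ w hw hw1) = AlgHom.id l _ := by
    refine quadricCoordRing_algHom_ext fun i => ?_
    rw [AlgHom.comp_apply, coordLift_coordPoint]
    change ψ (w i).re + ψ (w i).im * coordPoint _ 0 = coordPoint _ i
    fin_cases i
    · simp [w]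
    · simp [w, hx]
    · simp [w, hy]
    · simp [w, QuadraticAlgebra.re_one, QuadraticAlgebra.im_one, hl]
  exact ⟨coordLift _ w hw hw1, fun s t hst => by
    have := congrArg θ hst
    rwa [← AlgHom.comp_apply, ← AlgHom.comp_apply, hid] at this⟩

theorem NormIsotropic.map {R S : Type*} [CommRing R] [CommRing S] {f : R →+* S}
    (hf : Function.Injective f) {a b : R} (h : NormIsotropic a b) :
    NormIsotropic (f a) (f b) := by
  obtain ⟨x, hx0, hx⟩ := h
  refine ⟨fun i => f (x i), fun h => hx0 (funext fun i => hf ?_), ?_⟩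
  · simpa using congrFun h i
  · simpa using congrArg f hx

theorem NormIsotropic.of_fractionRing {R : Type*} [CommRing R] [IsDomain R] {a b : R}
    (h : NormIsotropic (algebraMap R (FractionRing R) a) (algebraMap R (FractionRing R) b)) :
    NormIsotropic a b := by
  have hinj := FaithfulSMul.algebraMap_injective R (FractionRing R)
  obtain ⟨x, hx0, hx⟩ := h
  obtain ⟨d, hd⟩ := IsLocalization.exist_integer_multiples_of_finite (nonZeroDivisors R) x
  choose y hy using hd
  have hd0 : algebraMap R (FractionRing R) d ≠ 0 :=
    (map_ne_zero_iff _ hinj).mpr (nonZeroDivisors.coe_ne_zero d)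
  simp only [Algebra.smul_def] at hy
  refine ⟨y, ?_, hinj ?_⟩
  · rintro rfl
    refine hx0 (funext fun i => ?_)
    have := hy i
    simpa [hd0] using this.symm
  · simp only [map_add, map_sub, map_mul, map_pow, hy, map_zero]
    linear_combination (algebraMap R (FractionRing R) d) ^ 2 * hx

theorem NormIsotropic.of_polynomial {R : Type*} [CommRing R] [IsDomain R] {a b : R}
    (h : NormIsotropic (Polynomial.C a) (Polynomial.C b)) : NormIsotropic a b := by
  obtain ⟨x, hx0, hx⟩ := h
  obtain ⟨j, hj⟩ := Finite.exists_max fun i => (x i).natDegree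
  have hc (i) : (x i ^ 2).coeff (2 * (x j).natDegree) = (x i).coeff (x j).natDegree ^ 2 := by
    rw [pow_two, two_mul, Polynomial.coeff_mul_add_eq_of_natDegree_le (hj i) (hj i), pow_two]
  refine ⟨fun i => (x i).coeff (x j).natDegree, fun h => ?_, ?_⟩
  · have h0 : x j = 0 := Polynomial.leadingCoeff_eq_zero.mp (congrFun h j)
    refine hx0 (funext fun i => ?_)
    have h1 := hj i
    rw [h0, Polynomial.natDegree_zero, Nat.le_zero] at h1
    have h2 := congrFun h i
    rw [Polynomial.eq_C_of_natDegree_eq_zero h1]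
    simpa [h0] using h2
  · have := congrArg (Polynomial.coeff · (2 * (x j).natDegree)) hx
    simpa only [← Polynomial.C_mul, Polynomial.coeff_add, Polynomial.coeff_sub,
      Polynomial.coeff_C_mul, hc, Polynomial.coeff_zero] using this

theorem exists_ternaryForm_eq_of_normIsotropic {R : Type*} [CommRing R] [IsDomain R]
    (h2 : (2 : R) ≠ 0) {a b e : R} (hN : ¬ NormIsotropic a b)
    (h : NormIsotropic (algebraMap R (QuadraticAlgebra R e 0) a)
      (algebraMap R (QuadraticAlgebra R e 0) b)) :
    ∃ (p : Fin 3 → R) (g : R), g ≠ 0 ∧ ternaryForm ![a, b, -(a * b)] p p = e * g ^ 2 := by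
  obtain ⟨x, hx0, hx⟩ := h
  let u : Fin 4 → R := fun i => (x i).re
  let v : Fin 4 → R := fun i => (x i).im
  have hre := congrArg QuadraticAlgebra.re hx
  have him := congrArg QuadraticAlgebra.im hx
  simp [pow_two] at hre him
  have hu : u 0 ^ 2 - a * u 1 ^ 2 - b * u 2 ^ 2 + a * b * u 3 ^ 2 +
      e * (v 0 ^ 2 - a * v 1 ^ 2 - b * v 2 ^ 2 + a * b * v 3 ^ 2) = 0 := by
    linear_combination hre
  have huv : u 0 * v 0 - a * (u 1 * v 1) - b * (u 2 * v 2) + a * b * (u 3 * v 3) = 0 := by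
    refine mul_left_cancel₀ h2 ?_
    linear_combination him
  have hv0 : v ≠ 0 := by
    intro hv
    simp only [hv, Pi.zero_apply] at hu
    refine hN ⟨u, fun h => hx0 (funext fun i => ?_), by linear_combination hu⟩
    exact QuadraticAlgebra.ext (congrFun h i) (congrFun hv i)
  refine ⟨![u 1 * v 0 - u 0 * v 1 + b * (u 2 * v 3 - u 3 * v 2),
    u 2 * v 0 - u 0 * v 2 - a * (u 1 * v 3 - u 3 * v 1),
    u 3 * v 0 - u 0 * v 3 - u 1 * v 2 + u 2 * v 1],
    v 0 ^ 2 - a * v 1 ^ 2 - b * v 2 ^ 2 + a * b * v 3 ^ 2, fun h => hN ⟨v, hv0, h⟩, ?_⟩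
  simp only [ternaryForm, Matrix.cons_val]
  linear_combination (u 0 * v 0 - a * (u 1 * v 1) - b * (u 2 * v 2) + a * b * (u 3 * v 3)) * huv -
    (v 0 ^ 2 - a * v 1 ^ 2 - b * v 2 ^ 2 + a * b * v 3 ^ 2) * hu

theorem exists_ternaryForm_polynomial_eq {l : Type*} [Field l] (h2 : (2 : l) ≠ 0)
    {a b a' b' c' : l} (ha' : a' ≠ 0) (hb' : b' ≠ 0) (hc' : c' ≠ 0) (hN : ¬ NormIsotropic a b)
    (h : NormIsotropic (algebraMap l (quadricFunctionField (diagQF a' b' c')) a)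
      (algebraMap l (quadricFunctionField (diagQF a' b' c')) b)) :
    ∃ (p : Fin 3 → Polynomial (Polynomial l)) (g : Polynomial (Polynomial l)), g ≠ 0 ∧
      ternaryForm (fun i => Polynomial.C (Polynomial.C (![a, b, -(a * b)] i))) p p =
        (Polynomial.C (Polynomial.C c' + Polynomial.C a' * Polynomial.X ^ 2) +
          Polynomial.C (Polynomial.C b') * Polynomial.X ^ 2) * g ^ 2 := by
  have := isDomain_quadricCoordRing h2 (nondegQF_diagQF h2 ha' hb' hc')
  let ψ : Polynomial (Polynomial l) →ₐ[l] quadricCoordRing (diagQF a' b' c') :=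
    { Polynomial.eval₂RingHom (Polynomial.aeval (R := l) (coordPoint (diagQF a' b' c') 1)).toRingHom
        (coordPoint (diagQF a' b' c') 2) with
      commutes' := fun s => by
        change Polynomial.eval₂ _ _ (Polynomial.C (Polynomial.C s)) = _
        simp }
  obtain ⟨f, hf⟩ := exists_injective_quadricCoordRing_diagQF (a := a') (b := b') (c := c')
    (R := Polynomial (Polynomial l)) (x := Polynomial.C Polynomial.X) (y := Polynomial.X)
    (e := Polynomial.C (Polynomial.C c' + Polynomial.C a' * Polynomial.X ^ 2) +
      Polynomial.C (Polynomial.C b') * Polynomial.X ^ 2)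
    (by
      rw [map_add, map_mul, map_pow]
      rfl) ψ
    (by
      change Polynomial.eval₂ _ _ (Polynomial.C Polynomial.X) = _
      simp)
    (by
      change Polynomial.eval₂ _ _ Polynomial.X = _
      simp)
  have h1 : NormIsotropic (algebraMap l (quadricCoordRing (diagQF a' b' c')) a)
      (algebraMap l (quadricCoordRing (diagQF a' b' c')) b) := by
    refine NormIsotropic.of_fractionRing ?_
    rwa [← IsScalarTower.algebraMap_apply, ← IsScalarTower.algebraMap_apply]
  have h3 := h1.map (f := f.toRingHom) hf
  obtain ⟨p, g, hg, hp⟩ := exists_ternaryForm_eq_of_normIsotropic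
    (a := Polynomial.C (Polynomial.C a)) (b := Polynomial.C (Polynomial.C b))
    (two_ne_zero_of_algebra l h2) (fun h => hN h.of_polynomial.of_polynomial)
    (by
      convert h3 using 1
      · exact (f.commutes a).symm
      · exact (f.commutes b).symm)
  refine ⟨p, g, hg, ?_⟩
  rw [← hp]
  simp [ternaryForm]

/-! ### Isometries between ternary forms from function fields -/

theorem exists_integral_multiple {R : Type*} [CommRing R] [IsDomain R]
    (u : Fin 3 → FractionRing R) : ∃ (d : R) (y : Fin 3 → R), d ≠ 0 ∧
      ∀ i, algebraMap R (FractionRing R) (y i) = algebraMap R (FractionRing R) d * u i := by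
  obtain ⟨d, hd⟩ := IsLocalization.exist_integer_multiples_of_finite (nonZeroDivisors R) u
  choose y hy using hd
  exact ⟨d, y, nonZeroDivisors.coe_ne_zero d, fun i => by simpa [Algebra.smul_def] using hy i⟩

theorem ternaryForm_mul_mul {R : Type*} [CommRing R] (w x y : Fin 3 → R) (s t : R) :
    ternaryForm w (fun i => s * x i) (fun i => t * y i) = s * t * ternaryForm w x y := by
  simp only [ternaryForm]
  ring

theorem ternaryForm_zero_right {R : Type*} [CommRing R] (w x : Fin 3 → R) :
    ternaryForm w x (fun _ => 0) = 0 := by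
  simp [ternaryForm]

theorem TernaryAnisotropic.fractionRing {R : Type*} [CommRing R] [IsDomain R] {w : Fin 3 → R}
    (hw : TernaryAnisotropic w) :
    TernaryAnisotropic fun i => algebraMap R (FractionRing R) (w i) := by
  intro u hu
  have hinj := FaithfulSMul.algebraMap_injective R (FractionRing R)
  obtain ⟨d, y, hd, hy⟩ := exists_integral_multiple u
  have hy0 : y = 0 := hw y (hinj (by
    rw [map_ternaryForm, map_zero, funext hy, ternaryForm_mul_mul, hu, mul_zero]))
  ext1 i
  have := hy i
  simpa [hy0, (map_ne_zero_iff _ hinj).mpr hd] using this.symm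

theorem exists_ternaryForm_orthogonal {F : Type*} [Field F] (h2 : (2 : F) ≠ 0)
    {w u v y : Fin 3 → F} (hvy : ternaryForm w v v = ternaryForm w y y)
    (hy : ternaryForm w y y ≠ 0) (huv : ternaryForm w u v = 0) :
    ∃ u', ternaryForm w u' u' = ternaryForm w u u ∧ ternaryForm w u' y = 0 := by
  have key (ε : F) (hε : ε * ε = 1)
      (hm : ternaryForm w (fun i => v i - ε * y i) (fun i => v i - ε * y i) ≠ 0) :
      ∃ u', ternaryForm w u' u' = ternaryForm w u u ∧ ternaryForm w u' y = 0 := by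
    set m := fun i => v i - ε * y i with hm'
    have hmm : ternaryForm w m m = -2 * ε * ternaryForm w m y := by
      simp only [ternaryForm, hm'] at hvy ⊢
      linear_combination hvy - (w 0 * y 0 * y 0 + w 1 * y 1 * y 1 + w 2 * y 2 * y 2) * hε
    have hum : ternaryForm w u m = -ε * ternaryForm w u y := by
      simp only [ternaryForm, hm'] at huv ⊢
      linear_combination huv
    set s := 2 * ternaryForm w u m / ternaryForm w m m with hs'
    have hs : s * ternaryForm w m m = 2 * ternaryForm w u m := div_mul_cancel₀ _ hm
    refine ⟨fun i => u i - s * m i, ?_, ?_⟩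
    · simp only [ternaryForm] at hs ⊢
      linear_combination s * hs
    · have e : ternaryForm w (fun i => u i - s * m i) y = ternaryForm w u y -
          s * ternaryForm w m y := by
        simp only [ternaryForm]
        ring
      have hε0 : ε ≠ 0 := left_ne_zero_of_mul_eq_one hε
      rw [e]
      refine mul_left_cancel₀ (mul_ne_zero h2 hε0) ?_
      linear_combination 2 * hum - s * hmm + hs
  by_cases hm : ternaryForm w (fun i => v i - 1 * y i) (fun i => v i - 1 * y i) = 0
  · refine key (-1) (by ring) fun hm' => hy ?_
    refine mul_left_cancel₀ (mul_ne_zero h2 h2) ?_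
    simp only [ternaryForm] at hm hm' hvy ⊢
    linear_combination hm + hm' - 2 * hvy
  · exact key 1 (by ring) hm

theorem exists_orthogonal_of_ternaryForm_polynomial {l : Type*} [Field l] (h2 : (2 : l) ≠ 0)
    {w : Fin 3 → l} (hw : TernaryAnisotropic w) {a b c : l} (hb : b ≠ 0)
    {p : Fin 3 → Polynomial (Polynomial l)} {g : Polynomial (Polynomial l)} (hg : g ≠ 0)
    (h : ternaryForm (fun i => Polynomial.C (Polynomial.C (w i))) p p =
        (Polynomial.C (Polynomial.C c + Polynomial.C a * Polynomial.X ^ 2) +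
          Polynomial.C (Polynomial.C b) * Polynomial.X ^ 2) * g ^ 2) :
    ∃ x y z : Fin 3 → l, ternaryForm w x x = a ∧ ternaryForm w y y = b ∧ ternaryForm w z z = c ∧
      ternaryForm w x y = 0 ∧ ternaryForm w x z = 0 ∧ ternaryForm w y z = 0 := by
  let F := FractionRing (Polynomial l)
  let ι := algebraMap (Polynomial l) F
  have hι : Function.Injective ι := FaithfulSMul.algebraMap_injective _ _
  have h2F : (2 : F) ≠ 0 := two_ne_zero_of_algebra l h2
  obtain ⟨u, v, hu, hv, huv, -, -⟩ := exists_ternaryForm_eq_of_polynomial h2F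
    hw.polynomial.fractionRing (fun _ => 0) (ι (Polynomial.C c + Polynomial.C a * Polynomial.X ^ 2))
    (ι (Polynomial.C b)) (fun i => (p i).map ι) (g.map ι) ((Polynomial.map_ne_zero_iff hι).mpr hg)
    (by
      have := congrArg (Polynomial.mapRingHom ι) h
      rw [map_ternaryForm] at this
      simpa only [Polynomial.coe_mapRingHom, Polynomial.map_C, Polynomial.map_mul,
        Polynomial.map_add, Polynomial.map_pow, Polynomial.map_X] using this)
    (by
      rw [Polynomial.C_0]
      exact ternaryForm_zero_right _ _)
  obtain ⟨y, hy⟩ : ∃ y, ternaryForm w y y = b := by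
    obtain ⟨d, q, hd, hq⟩ := exists_integral_multiple v
    obtain ⟨y, -, hy, -⟩ := exists_ternaryForm_eq_of_polynomial h2 hw (fun _ => 0) b 0 q d hd
      (hι (by
        rw [map_ternaryForm, funext hq, ternaryForm_mul_mul]
        erw [hv]
        rw [map_mul, map_pow, map_add, map_mul, map_zero, map_zero]
        ring))
      (by
        rw [Polynomial.C_0]
        exact ternaryForm_zero_right _ _)
    exact ⟨y, hy⟩
  have hyF : ternaryForm (fun i => ι (Polynomial.C (w i))) (fun i => ι (Polynomial.C (y i)))
      (fun i => ι (Polynomial.C (y i))) = ι (Polynomial.C b) := by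
    rw [← hy, map_ternaryForm Polynomial.C, map_ternaryForm ι]
  obtain ⟨u', hu', huy⟩ := exists_ternaryForm_orthogonal h2F (hv.trans hyF.symm)
    (by
      rw [hyF]
      exact (map_ne_zero_iff _ hι).mpr (Polynomial.C_ne_zero.mpr hb)) huv
  obtain ⟨d, q, hd, hq⟩ := exists_integral_multiple u'
  obtain ⟨z, x, hz, hx, hzx, hzy, hxy⟩ := exists_ternaryForm_eq_of_polynomial h2 hw y c a q d hd
    (hι (by
      rw [map_ternaryForm, funext hq, ternaryForm_mul_mul]
      erw [hu', hu]
      rw [map_mul ι, map_pow]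
      ring))
    (hι (by
      rw [map_ternaryForm, funext hq, map_zero]
      have := ternaryForm_mul_mul (fun i => ι (Polynomial.C (w i))) u'
        (fun i => ι (Polynomial.C (y i))) (ι d) 1
      rw [huy, mul_zero] at this
      simpa only [one_mul] using this))
  refine ⟨x, y, z, hx, hy, hz, hxy, ?_, ?_⟩
  · rw [← hzx]
    simp only [ternaryForm]
    ring
  · rw [← hzy]
    simp only [ternaryForm]
    ring

theorem ternaryAnisotropic_of_not_normIsotropic {l : Type*} [CommRing l] {a b : l}
    (h : ¬ NormIsotropic a b) : TernaryAnisotropic ![a, b, -(a * b)] := by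
  intro x hx
  by_contra hx0
  refine h ⟨![0, x 0, x 1, x 2], fun h0 => hx0 (funext fun i => ?_), ?_⟩
  · have := congrFun h0 i.succ
    fin_cases i <;> exact this
  · simp only [ternaryForm, Matrix.cons_val] at hx ⊢
    linear_combination -hx

theorem diagQF_isotropic_iff {K : Type*} [Field K] {a b c δ : K} (ha : a ≠ 0) (hb : b ≠ 0)
    (hc : c ≠ 0) (hδ : -(a * b * c) = δ ^ 2) :
    (∃ x, x ≠ 0 ∧ diagQF a b c x = 0) ↔ NormIsotropic a b := by
  have hδ0 : δ ≠ 0 := by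
    rintro rfl
    simp [ha, hb, hc] at hδ
  constructor
  · rintro ⟨x, hx0, hx⟩
    refine ⟨![x 0, x 1, x 2, δ / (a * b) * x 3], fun h => hx0 (funext fun i => ?_), ?_⟩
    · have := congrFun h i
      fin_cases i
      · exact this
      · exact this
      · exact this
      · simpa [hδ0, ha, hb] using this
    · rw [diagQF_apply] at hx
      simp only [Matrix.cons_val]
      field_simp
      rw [← hδ]
      linear_combination a * b * hx
  · rintro ⟨x, hx0, hx⟩
    refine ⟨![x 0, x 1, x 2, a * b / δ * x 3], fun h => hx0 (funext fun i => ?_), ?_⟩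
    · have := congrFun h i
      fin_cases i
      · exact this
      · exact this
      · exact this
      · simpa [hδ0, ha, hb] using this
    · rw [diagQF_apply]
      simp only [Matrix.cons_val]
      field_simp
      rw [← hδ]
      linear_combination -(a * b * c) * hx

theorem exists_isometry_of_splitsIn {l : Type*} [Field l] (h2 : (2 : l) ≠ 0)
    {a b c a' b' c' δ : l} (ha : a ≠ 0) (hb : b ≠ 0) (hc : c ≠ 0) (ha' : a' ≠ 0) (hb' : b' ≠ 0)
    (hc' : c' ≠ 0) (hδ : -(a * b * c) = δ ^ 2) (haniso : ∀ x, diagQF a b c x = 0 → x = 0)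
    (h : SplitsIn l ℍ[l,a,b] (quadricFunctionField (diagQF a b c)) →
      SplitsIn l ℍ[l,a,b] (quadricFunctionField (diagQF a' b' c'))) :
    ∃ M : Matrix (Fin 3) (Fin 3) l,
      M.transpose * Matrix.diagonal ![a, b, c] * M = Matrix.diagonal ![a', b', c'] := by
  have hN : ¬ NormIsotropic a b := fun hN => by
    obtain ⟨x, hx0, hx⟩ := (diagQF_isotropic_iff ha hb hc hδ).mpr hN
    exact hx0 (haniso x hx)
  have hD := nondegQF_diagQF h2 ha hb hc
  have := isDomain_quadricCoordRing h2 hD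
  have := isDomain_quadricCoordRing h2 (nondegQF_diagQF h2 ha' hb' hc')
  have hsplit : SplitsIn l ℍ[l,a,b] (quadricFunctionField (diagQF a b c)) := by
    let K := quadricFunctionField (diagQF a b c)
    let A := quadricCoordRing (diagQF a b c)
    have hinj := (algebraMap l K).injective
    refine splitsIn_of_normIsotropic h2 ha hb ((diagQF_isotropic_iff (c := algebraMap l K c)
      (δ := algebraMap l K δ) ?_ ?_ ?_ ?_).mp ?_)
    · exact (map_ne_zero_iff _ hinj).mpr ha
    · exact (map_ne_zero_iff _ hinj).mpr hb
    · exact (map_ne_zero_iff _ hinj).mpr hc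
    · simpa using congrArg (algebraMap l K) hδ
    · refine ⟨fun i => algebraMap A K (coordPoint _ i), fun h => ?_, ?_⟩
      · have := congrFun h 3
        simp [coordPoint_last (diagQF a b c) 3 (by decide)] at this
      · rw [← extendQF_diagQF]
        have := extendQF_map (diagQF a b c) (IsScalarTower.toAlgHom l A K) (coordPoint _)
        rw [extendQF_coordPoint, map_zero] at this
        exact this.symm
  obtain ⟨p, g, hg, hp⟩ := exists_ternaryForm_polynomial_eq h2 ha' hb' hc' hN
    (normIsotropic_of_splitsIn (h hsplit))
  obtain ⟨x, y, z, hx, hy, hz, hxy, hxz, hyz⟩ := exists_orthogonal_of_ternaryForm_polynomial h2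
    (ternaryAnisotropic_of_not_normIsotropic hN) hb' hg hp
  have hδ0 : δ ≠ 0 := by
    rintro rfl
    simp [ha, hb, hc] at hδ
  have hcab : c * (a * b / δ) ^ 2 = -(a * b) := by
    field_simp
    rw [← hδ]
    ring
  refine ⟨!![x 0, y 0, z 0; x 1, y 1, z 1;
    a * b / δ * x 2, a * b / δ * y 2, a * b / δ * z 2], ?_⟩
  simp only [ternaryForm, Matrix.cons_val] at hx hy hz hxy hxz hyz
  ext i j
  rw [Matrix.mul_apply, Fin.sum_univ_three]
  simp only [Matrix.mul_diagonal, Matrix.transpose_apply]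
  fin_cases i <;> fin_cases j <;> simp
  · linear_combination hx + x 2 * x 2 * hcab
  · linear_combination hxy + x 2 * y 2 * hcab
  · linear_combination hxz + x 2 * z 2 * hcab
  · linear_combination hxy + x 2 * y 2 * hcab
  · linear_combination hy + y 2 * y 2 * hcab
  · linear_combination hyz + y 2 * z 2 * hcab
  · linear_combination hxz + x 2 * z 2 * hcab
  · linear_combination hyz + y 2 * z 2 * hcab
  · linear_combination hz + z 2 * z 2 * hcab

/-! ### Descent of ternary isometries along a quadratic extension -/

theorem nonempty_functionField_diagQF_algEquiv_of_ternary {k : Type*} [Field k] (h2 : (2 : k) ≠ 0)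
    {a b c a' b' c' : k} (ha : a ≠ 0) (hb : b ≠ 0) (hc : c ≠ 0) (ha' : a' ≠ 0) (hb' : b' ≠ 0)
    (hc' : c' ≠ 0) {M : Matrix (Fin 3) (Fin 3) k}
    (hM : M.transpose * Matrix.diagonal ![a, b, c] * M = Matrix.diagonal ![a', b', c']) :
    Nonempty (quadricFunctionField (diagQF a' b' c') ≃ₐ[k] quadricFunctionField (diagQF a b c)) := by
  have hdet : M.det ≠ 0 := by
    intro h0
    have := congrArg Matrix.det hM
    rw [Matrix.det_mul, h0, mul_zero, Matrix.det_diagonal, Fin.prod_univ_three] at this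
    exact mul_ne_zero (mul_ne_zero ha' hb') hc' this.symm
  let T : Matrix (Fin 4) (Fin 4) k :=
    Matrix.of (Fin.cons (Fin.cons 1 0) fun i => Fin.cons 0 (M i))
  have hT : T.det = M.det := by
    rw [Matrix.det_succ_row_zero, Fin.sum_univ_succ]
    have : T.submatrix Fin.succ (Fin.succAbove 0) = M := by
      ext i j
      simp [T]
    rw [this]
    simp [T]
  refine nonempty_functionField_algEquiv_of_mulVec h2 (nondegQF_diagQF h2 ha' hb' hc')
    (nondegQF_diagQF h2 ha hb hc) (M := T) (hT ▸ hdet) one_ne_zero fun x => ?_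
  have e (i j : Fin 3) := congrFun (congrFun hM i) j
  simp only [Matrix.mul_apply, Fin.sum_univ_three, Matrix.transpose_apply] at e
  have e00 := e 0 0
  have e01 := e 0 1
  have e02 := e 0 2
  have e11 := e 1 1
  have e12 := e 1 2
  have e22 := e 2 2
  simp at e00 e01 e02 e11 e12 e22
  have t0 : T.mulVec x 0 = x 0 := by simp [T, Matrix.mulVec, dotProduct, Fin.sum_univ_succ]
  have ts (i : Fin 3) : T.mulVec x i.succ = M i 0 * x 1 + M i 1 * x 2 + M i 2 * x 3 := by
    simp [T, Matrix.mulVec, dotProduct, Fin.sum_univ_succ]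
    ring
  have t1 := ts 0
  have t2 := ts 1
  have t3 := ts 2
  change T.mulVec x 1 = _ at t1
  change T.mulVec x 2 = _ at t2
  change T.mulVec x 3 = _ at t3
  rw [diagQF_apply, diagQF_apply, t0, t1, t2, t3]
  linear_combination -x 1 ^ 2 * e00 - x 2 ^ 2 * e11 - x 3 ^ 2 * e22 - 2 * x 1 * x 2 * e01 -
    2 * x 1 * x 3 * e02 - 2 * x 2 * x 3 * e12

theorem polar_diagQF {k : Type*} [CommRing k] (a b c : k) (x y : Fin 4 → k) :
    QuadraticMap.polar (diagQF a b c) x y =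
      2 * (x 0 * y 0 - a * x 1 * y 1 - b * x 2 * y 2 - c * x 3 * y 3) := by
  simp only [QuadraticMap.polar, diagQF_apply, Pi.add_apply]
  ring

theorem diagQF_quadraticAlgebra_anisotropic {k : Type*} [Field k] (h2 : (2 : k) ≠ 0)
    {a b c : k} (ha : a ≠ 0) (hb : b ≠ 0) (hc : c ≠ 0) (haniso : ∀ x, diagQF a b c x = 0 → x = 0)
    (x : Fin 4 → QuadraticAlgebra k (-(a * b * c)) 0)
    (hx : diagQF (algebraMap k (QuadraticAlgebra k (-(a * b * c)) 0) a)
      (algebraMap k (QuadraticAlgebra k (-(a * b * c)) 0) b)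
      (algebraMap k (QuadraticAlgebra k (-(a * b * c)) 0) c) x = 0) : x = 0 := by
  let u : Fin 4 → k := fun i => (x i).re
  let v : Fin 4 → k := fun i => (x i).im
  rw [diagQF_apply] at hx
  have hre := congrArg QuadraticAlgebra.re hx
  have him := congrArg QuadraticAlgebra.im hx
  simp [pow_two] at hre him
  have hu : diagQF a b c u - a * b * c * diagQF a b c v = 0 := by
    rw [diagQF_apply, diagQF_apply]
    linear_combination hre
  have huv : u 0 * v 0 - a * u 1 * v 1 - b * u 2 * v 2 - c * u 3 * v 3 = 0 := by
    refine mul_left_cancel₀ h2 ?_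
    linear_combination him
  by_cases hv0 : v = 0
  · have hu0 := haniso u (by simpa [hv0] using hu)
    exact funext fun i => QuadraticAlgebra.ext (congrFun hu0 i) (congrFun hv0 i)
  exfalso
  have hqv : diagQF a b c v ≠ 0 := fun h => hv0 (haniso v h)
  let pol := QuadraticMap.polarBilin (diagQF a b c)
  obtain ⟨z, hz0, hz⟩ := exists_ne_zero_of_linearForms (k := k) (m := 2) (n := 4) (by norm_num)
    ![pol u, pol v]
  obtain ⟨y, hy0, hy⟩ := exists_ne_zero_of_linearForms (k := k) (m := 3) (n := 4) (by norm_num)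
    ![pol u, pol v, pol z]
  have key {s t : Fin 4 → k} (h : pol s t = 0) :
      s 0 * t 0 - a * s 1 * t 1 - b * s 2 * t 2 - c * s 3 * t 3 = 0 := by
    rw [QuadraticMap.polarBilin_apply_apply, polar_diagQF] at h
    exact (mul_eq_zero.mp h).resolve_left h2
  have huz := key (hz 0)
  have hvz := key (hz 1)
  have huy := key (hy 0)
  have hvy := key (hy 1)
  have hzy := key (hy 2)
  have hqz : diagQF a b c z ≠ 0 := fun h => hz0 (haniso z h)
  have hqy : diagQF a b c y ≠ 0 := fun h => hy0 (haniso y h)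
  let Y : Matrix (Fin 4) (Fin 4) k := Matrix.of ![u, v, z, y]
  have hgram : Y * Matrix.diagonal ![1, -a, -b, -c] * Y.transpose =
      Matrix.diagonal ![diagQF a b c u, diagQF a b c v, diagQF a b c z, diagQF a b c y] := by
    ext i j
    rw [Matrix.mul_apply, Fin.sum_univ_four]
    simp only [Matrix.mul_diagonal, Matrix.transpose_apply, Y]
    fin_cases i <;> fin_cases j <;> simp [diagQF_apply] <;>
      first
      | ring1
      | linear_combination huv
      | linear_combination huz
      | linear_combination huy
      | linear_combination hvz
      | linear_combination hvy
      | linear_combination hzy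
  have hd := congrArg Matrix.det hgram
  rw [Matrix.det_mul, Matrix.det_mul, Matrix.det_transpose, Matrix.det_diagonal,
    Matrix.det_diagonal, Fin.prod_univ_four, Fin.prod_univ_four] at hd
  simp at hd
  set r := Y.det / diagQF a b c v with hr'
  have hr : Y.det = r * diagQF a b c v := (div_mul_cancel₀ _ hqv).symm
  have hr2 : r ^ 2 = -(diagQF a b c z * diagQF a b c y) := by
    have hne : -(a * b * c) * diagQF a b c v ^ 2 ≠ 0 := by simp [ha, hb, hc, hqv]
    refine mul_left_cancel₀ hne ?_
    rw [hr] at hd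
    linear_combination hd + diagQF a b c v * diagQF a b c z * diagQF a b c y * hu
  have h0 : (fun i => diagQF a b c y * z i + r * y i) = 0 := by
    refine haniso _ ?_
    have : diagQF a b c (fun i => diagQF a b c y * z i + r * y i) =
        diagQF a b c y ^ 2 * diagQF a b c z + r ^ 2 * diagQF a b c y := by
      simp only [diagQF_apply]
      linear_combination 2 * r * (y 0 ^ 2 - a * y 1 ^ 2 - b * y 2 ^ 2 - c * y 3 ^ 2) * hzy
    rw [this, hr2]
    ring
  have h3 : diagQF a b c y * diagQF a b c z = 0 := by
    have e (i) : diagQF a b c y * z i + r * y i = 0 := congrFun h0 i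
    rw [diagQF_apply a b c z]
    linear_combination z 0 * e 0 - a * z 1 * e 1 - b * z 2 * e 2 - c * z 3 * e 3 - r * hzy
  exact mul_ne_zero hqy hqz h3

theorem exists_norm_mul_norm {k : Type*} [Field k] {α d u₀ u₁ t₀ t₁ : k} (hα : α ≠ 0)
    (h : u₀ * u₁ = α * t₀ * t₁) : ∃ p r s t : k,
      u₀ ^ 2 + d * u₁ ^ 2 - α * (t₀ ^ 2 + d * t₁ ^ 2) =
        (p ^ 2 - α * r ^ 2) * (s ^ 2 - α * d * t ^ 2) := by
  by_cases hu : u₀ = 0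
  · have h0 : t₀ * t₁ = 0 := by
      refine (mul_eq_zero.mp ?_).resolve_left hα
      rw [hu] at h
      linear_combination -h
    rcases mul_eq_zero.mp h0 with h0 | h0
    · refine ⟨t₁, u₁ / α, 0, 1, ?_⟩
      rw [hu, h0]
      field_simp
      ring
    · refine ⟨0, 1, t₀, u₁ / α, ?_⟩
      rw [hu, h0]
      field_simp
      ring
  · refine ⟨u₀, t₀, 1, t₁ / u₀, ?_⟩
    have : u₁ = α * t₀ * t₁ / u₀ := by rw [← h, mul_div_cancel_left₀ _ hu]
    rw [this]
    field_simp
    ring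

theorem nonempty_functionField_diagQF_algEquiv_of_represents {k : Type*} [Field k]
    (h2 : (2 : k) ≠ 0) {α β γ β' γ' p r s t m n : k} (hα : α ≠ 0) (hβ : β ≠ 0) (hγ : γ ≠ 0)
    (hβ' : β' ≠ 0) (hγ' : γ' ≠ 0) (hn0 : n ≠ 0) (hn : n = p ^ 2 - α * r ^ 2)
    (hs : n * β' = β * s ^ 2 + γ * t ^ 2) (hm : β' * γ' = m ^ 2 * (β * γ)) :
    Nonempty (quadricFunctionField (diagQF α β' γ') ≃ₐ[k]
      quadricFunctionField (diagQF α β γ)) := by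
  have hm0 : m ≠ 0 := by
    rintro rfl
    exact mul_ne_zero hβ' hγ' (hm.trans (by ring))
  obtain ⟨κ, hκ⟩ : ∃ κ, κ * β' = m := ⟨m / β', div_mul_cancel₀ _ hβ'⟩
  have hκ' : κ ^ 2 * (β * γ) * β' = γ' := by
    refine mul_left_cancel₀ hβ' ?_
    rw [hm, ← hκ]
    ring
  let T : Matrix (Fin 4) (Fin 4) k :=
    !![p, α * r, 0, 0; r, p, 0, 0; 0, 0, s, -(γ * t * κ); 0, 0, t, β * s * κ]
  have hdet : T.det = n ^ 2 * m := by
    have : T.det = (p ^ 2 - α * r ^ 2) * κ * (β * s ^ 2 + γ * t ^ 2) := by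
      simp [T, Matrix.det_succ_row_zero, Fin.sum_univ_succ, Fin.succAbove]
      ring
    rw [this, ← hn, ← hs, ← hκ]
    ring
  refine nonempty_functionField_algEquiv_of_mulVec h2 (nondegQF_diagQF h2 hα hβ' hγ')
    (nondegQF_diagQF h2 hα hβ hγ) (M := T) (c := n)
    (hdet ▸ mul_ne_zero (pow_ne_zero 2 hn0) hm0) hn0 fun x => ?_
  rw [diagQF_apply, diagQF_apply]
  simp [T, Matrix.mulVec, dotProduct, Fin.sum_univ_four]
  linear_combination (-x 0 ^ 2 + α * x 1 ^ 2) * hn + (x 2 ^ 2 + κ ^ 2 * β * γ * x 3 ^ 2) * hs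
    - n * x 3 ^ 2 * hκ'

theorem ternaryForm_eq_dotProduct {R : Type*} [CommRing R] (w x y : Fin 3 → R) :
    ternaryForm w x y = x ⬝ᵥ (Matrix.diagonal w).mulVec y := by
  simp [ternaryForm, dotProduct, Fin.sum_univ_three, Matrix.mulVec_diagonal]
  ring

theorem ternaryForm_mulVec {R : Type*} [CommRing R] {w w' : Fin 3 → R}
    {M : Matrix (Fin 3) (Fin 3) R}
    (hM : M.transpose * Matrix.diagonal w * M = Matrix.diagonal w') (x y : Fin 3 → R) :
    ternaryForm w (M.mulVec x) (M.mulVec y) = ternaryForm w' x y := by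
  rw [ternaryForm_eq_dotProduct, ternaryForm_eq_dotProduct, ← hM, ← Matrix.vecMul_transpose,
    ← Matrix.dotProduct_mulVec, Matrix.mulVec_mulVec, Matrix.mulVec_mulVec, mul_assoc]

theorem TernaryAnisotropic.exists_orthogonal_basis {k : Type*} [Field k] {w : Fin 3 → k}
    (hw : TernaryAnisotropic w) (x : Fin 3 → k) :
    ∃ (S : Matrix (Fin 3) (Fin 3) k) (β γ : k), β ≠ 0 ∧ γ ≠ 0 ∧ (∀ i, S i 0 = x i) ∧
      S.transpose * Matrix.diagonal w * S = Matrix.diagonal ![ternaryForm w x x, β, γ] := by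
  let f (x : Fin 3 → k) : (Fin 3 → k) →ₗ[k] k := ∑ i, (w i * x i) • LinearMap.proj i
  have hf (x y) : f x y = ternaryForm w x y := by
    simp [f, Fin.sum_univ_three, ternaryForm]
  obtain ⟨y, hy0, hy⟩ := exists_ne_zero_of_linearForms (by norm_num : 1 < 3) ![f x]
  obtain ⟨z, hz0, hz⟩ := exists_ne_zero_of_linearForms (by norm_num : 2 < 3) ![f x, f y]
  have hxy : ternaryForm w x y = 0 := (hf x y).symm.trans (hy 0)
  have hxz : ternaryForm w x z = 0 := (hf x z).symm.trans (hz 0)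
  have hyz : ternaryForm w y z = 0 := (hf y z).symm.trans (hz 1)
  refine ⟨(Matrix.of ![x, y, z]).transpose, ternaryForm w y y, ternaryForm w z z,
    fun h => hy0 (hw y h), fun h => hz0 (hw z h), fun i => rfl, ?_⟩
  simp only [ternaryForm] at hxy hxz hyz ⊢
  ext i j
  rw [Matrix.mul_apply, Fin.sum_univ_three]
  simp only [Matrix.mul_diagonal, Matrix.transpose_apply]
  fin_cases i <;> fin_cases j <;> simp <;>
    first
    | ring1
    | linear_combination hxy
    | linear_combination hxz
    | linear_combination hyz

theorem det_sq_mul_prod {R : Type*} [CommRing R] {w w' : Fin 3 → R} {M : Matrix (Fin 3) (Fin 3) R}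
    (hM : M.transpose * Matrix.diagonal w * M = Matrix.diagonal w') :
    M.det ^ 2 * (w 0 * w 1 * w 2) = w' 0 * w' 1 * w' 2 := by
  have := congrArg Matrix.det hM
  rw [Matrix.det_mul, Matrix.det_mul, Matrix.det_transpose, Matrix.det_diagonal,
    Matrix.det_diagonal, Fin.prod_univ_three, Fin.prod_univ_three] at this
  linear_combination this

theorem det_map_im_eq_zero {k : Type*} [Field k] (h2 : (2 : k) ≠ 0) {d : k}
    [Fact (∀ r : k, r ^ 2 ≠ d + 0 * r)] {w w' : Fin 3 → k} (hw : ∀ i, w i ≠ 0)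
    {M : Matrix (Fin 3) (Fin 3) (QuadraticAlgebra k d 0)}
    (hM : M.transpose * Matrix.diagonal (fun i => algebraMap k (QuadraticAlgebra k d 0) (w i)) * M =
      Matrix.diagonal fun i => algebraMap k (QuadraticAlgebra k d 0) (w' i))
    (hdet : M.det ≠ 0) (him : M.det.im = 0) : (M.map QuadraticAlgebra.im).det = 0 := by
  let σ := starRingEnd (QuadraticAlgebra k d 0)
  have hσ (s : k) : σ (algebraMap k (QuadraticAlgebra k d 0) s) = algebraMap k _ s := by
    refine QuadraticAlgebra.ext ?_ ?_ <;> simp [σ, starRingEnd_apply]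
  have hσdet : (M.map σ).det = M.det := by
    rw [← RingHom.mapMatrix_apply, ← RingHom.map_det]
    refine QuadraticAlgebra.ext ?_ ?_ <;> simp [σ, starRingEnd_apply, him]
  set G := Matrix.diagonal fun i => algebraMap k (QuadraticAlgebra k d 0) (w i) with hG
  have hM' : (M.map σ).transpose * G * M.map σ =
      Matrix.diagonal fun i => algebraMap k (QuadraticAlgebra k d 0) (w' i) := by
    have := congrArg (fun A => A.map σ) hM
    simp only [Matrix.map_mul, hG] at this
    rw [Matrix.diagonal_map (map_zero σ), Matrix.diagonal_map (map_zero σ)] at this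
    simpa only [hσ, ← Matrix.transpose_map] using this
  have key : M.transpose * G * (M - M.map σ) = -((M - M.map σ).transpose * G * M.map σ) := by
    rw [mul_sub, Matrix.transpose_sub, sub_mul, sub_mul, hM, hM']
    abel
  have hGdet : G.det ≠ 0 := by
    rw [hG, Matrix.det_diagonal]
    exact Finset.prod_ne_zero_iff.mpr fun i _ =>
      (map_ne_zero_iff _ (algebraMap k (QuadraticAlgebra k d 0)).injective).mpr (hw i)
  have hdet0 : (M - M.map σ).det = 0 := by
    have := congrArg Matrix.det key
    rw [Matrix.det_neg, Matrix.det_mul, Matrix.det_mul, Matrix.det_mul, Matrix.det_mul,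
      Matrix.det_transpose, Matrix.det_transpose, hσdet] at this
    have h4 : (2 : QuadraticAlgebra k d 0) ≠ 0 := two_ne_zero_of_algebra k h2
    refine mul_left_cancel₀ (mul_ne_zero (mul_ne_zero h4 hdet) hGdet) ?_
    simp at this
    linear_combination this
  have hsub : M - M.map σ = (⟨0, 2⟩ : QuadraticAlgebra k d 0) •
      (algebraMap k (QuadraticAlgebra k d 0)).mapMatrix (M.map QuadraticAlgebra.im) := by
    refine Matrix.ext fun i j => QuadraticAlgebra.ext ?_ ?_
    · simp [σ, starRingEnd_apply]
    · simp [σ, starRingEnd_apply]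
      ring
  rw [hsub, Matrix.det_smul, ← RingHom.map_det] at hdet0
  have h0 : (⟨0, 2⟩ : QuadraticAlgebra k d 0) ≠ 0 := fun h => h2 (congrArg QuadraticAlgebra.im h)
  have := (mul_eq_zero.mp hdet0).resolve_left (pow_ne_zero _ h0)
  exact (map_eq_zero_iff _ (algebraMap k (QuadraticAlgebra k d 0)).injective).mp this

theorem nonempty_functionField_diagQF_algEquiv_of_quadraticAlgebra {k : Type*} [Field k]
    (h2 : (2 : k) ≠ 0) {α β γ β' γ' d σ m : k} (hα : α ≠ 0) (hβ : β ≠ 0) (hγ : γ ≠ 0)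
    (hβ' : β' ≠ 0) (hγ' : γ' ≠ 0) (hσ : σ ^ 2 * d = -(α * β * γ))
    (hm : β' * γ' = m ^ 2 * (β * γ)) {U W : QuadraticAlgebra k d 0}
    (h : algebraMap k (QuadraticAlgebra k d 0) β' = algebraMap k (QuadraticAlgebra k d 0) β * U ^ 2 +
      algebraMap k (QuadraticAlgebra k d 0) γ * W ^ 2) :
    Nonempty (quadricFunctionField (diagQF α β' γ') ≃ₐ[k]
      quadricFunctionField (diagQF α β γ)) := by
  have hσ0 : σ ≠ 0 := by
    rintro rfl
    exact mul_ne_zero (mul_ne_zero hα hβ) hγ (by linear_combination hσ)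
  have hre := congrArg QuadraticAlgebra.re h
  have him := congrArg QuadraticAlgebra.im h
  simp [pow_two] at hre him
  have him' : β * (U.re * U.im) + γ * (W.re * W.im) = 0 := by
    refine mul_left_cancel₀ h2 ?_
    linear_combination -him
  obtain ⟨p, r, s, t, hn⟩ := exists_norm_mul_norm (d := d) (u₀ := U.re) (u₁ := U.im)
    (t₀ := σ * d * W.im / (α * β)) (t₁ := σ * W.re / (α * β)) hα (by
      field_simp
      linear_combination α * β * him' - W.re * W.im * hσ)
  have hn' : β' = β * ((p ^ 2 - α * r ^ 2) * (s ^ 2 - α * d * t ^ 2)) := by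
    rw [← hn, hre]
    field_simp
    linear_combination (W.re ^ 2 + d * W.im ^ 2) * hσ
  refine nonempty_functionField_diagQF_algEquiv_of_represents h2 hα hβ hγ hβ' hγ'
    (n := p ^ 2 - α * r ^ 2) (s := (p ^ 2 - α * r ^ 2) * s)
    (t := (p ^ 2 - α * r ^ 2) * t * α * β / σ) (fun h0 => hβ' (by rw [hn', h0]; ring)) rfl ?_ hm
  rw [hn']
  field_simp
  linear_combination (-(p ^ 2 - α * r ^ 2) ^ 2 * α * t ^ 2) * hσ

theorem ternaryAnisotropic_of_diagQF {K : Type*} [Field K] {a b c : K}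
    (h : ∀ x, diagQF a b c x = 0 → x = 0) : TernaryAnisotropic ![a, b, c] := fun x hx => by
  have := h ![0, x 0, x 1, x 2] (by
    rw [diagQF_apply]
    simp [ternaryForm] at hx ⊢
    linear_combination -hx)
  ext i
  fin_cases i
  · exact congrFun this 1
  · exact congrFun this 2
  · exact congrFun this 3

theorem TernaryAnisotropic.of_mulVec {R : Type*} [CommRing R] [IsDomain R] {w w' : Fin 3 → R}
    (hw : TernaryAnisotropic w) {M : Matrix (Fin 3) (Fin 3) R} (hdet : M.det ≠ 0)
    (hM : M.transpose * Matrix.diagonal w * M = Matrix.diagonal w') : TernaryAnisotropic w' :=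
  fun x hx => Matrix.eq_zero_of_mulVec_eq_zero hdet (hw _ (by rw [ternaryForm_mulVec hM, hx]))

theorem TernaryAnisotropic.of_algebraMap {k K : Type*} [Field k] [Field K] [Algebra k K]
    {w : Fin 3 → k} (hw : TernaryAnisotropic fun i => algebraMap k K (w i)) :
    TernaryAnisotropic w := fun x hx => by
  have := hw (fun i => algebraMap k K (x i)) (by
    rw [← map_ternaryForm (algebraMap k K), hx, map_zero])
  ext i
  simpa using congrFun this i

theorem map_cons_three {α β : Type*} (f : α → β) (a b c : α) :
    ![f a, f b, f c] = fun i => f (![a, b, c] i) := by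
  ext i
  fin_cases i <;> rfl

theorem diagQF_eq_sub_ternaryForm {R : Type*} [CommRing R] (a b c : R) (x : Fin 4 → R) :
    diagQF a b c x = x 0 ^ 2 - ternaryForm ![a, b, c] (fun i => x i.succ) fun i => x i.succ := by
  rw [diagQF_apply]
  simp [ternaryForm]
  ring

theorem diagQF_anisotropic_of_isometry {K : Type*} [Field K] {a b c a' b' c' : K}
    {M : Matrix (Fin 3) (Fin 3) K} (hdet : M.det ≠ 0)
    (hM : M.transpose * Matrix.diagonal ![a, b, c] * M = Matrix.diagonal ![a', b', c'])
    (h : ∀ x, diagQF a b c x = 0 → x = 0) (x : Fin 4 → K) (hx : diagQF a' b' c' x = 0) : x = 0 := by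
  have := h (Fin.cons (x 0) (M.mulVec fun i => x i.succ)) (by
    rw [diagQF_eq_sub_ternaryForm] at hx ⊢
    simpa [ternaryForm_mulVec hM] using hx)
  have h0 : (fun i : Fin 3 => x i.succ) = 0 :=
    Matrix.eq_zero_of_mulVec_eq_zero hdet (funext fun i => by simpa using congrFun this i.succ)
  exact funext (Fin.cases (congrFun this 0) (congrFun h0))

theorem TernaryAnisotropic.exists_orthogonal_bases {k K : Type*} [Field k] [Field K] [Algebra k K]
    {w w' : Fin 3 → k} (hw : TernaryAnisotropic w) (hw' : TernaryAnisotropic w')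
    {M : Matrix (Fin 3) (Fin 3) K}
    (hM : M.transpose * Matrix.diagonal (fun i => algebraMap k K (w i)) * M =
      Matrix.diagonal fun i => algebraMap k K (w' i))
    {x y : Fin 3 → k} (hy : y ≠ 0)
    (hxy : M.mulVec (fun i => algebraMap k K (x i)) = fun i => algebraMap k K (y i)) :
    ∃ (S S' : Matrix (Fin 3) (Fin 3) k) (α β γ β' γ' : k) (U W : K),
      α ≠ 0 ∧ β ≠ 0 ∧ γ ≠ 0 ∧ β' ≠ 0 ∧ γ' ≠ 0 ∧
      S.transpose * Matrix.diagonal w * S = Matrix.diagonal ![α, β, γ] ∧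
      S'.transpose * Matrix.diagonal w' * S' = Matrix.diagonal ![α, β', γ'] ∧
      algebraMap k K β' = algebraMap k K β * U ^ 2 + algebraMap k K γ * W ^ 2 := by
  let f : k →+* K := algebraMap k K
  have hf : Function.Injective f := f.injective
  have hα : ternaryForm w y y = ternaryForm w' x x := by
    apply hf
    rw [map_ternaryForm, map_ternaryForm, ← hxy, ternaryForm_mulVec hM]
  obtain ⟨S, β, γ, hβ, hγ, hS0, hS⟩ := hw.exists_orthogonal_basis y
  obtain ⟨S', β', γ', hβ', hγ', hS0', hS'⟩ := hw'.exists_orthogonal_basis x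
  rw [← hα] at hS'
  have hα0 : ternaryForm w y y ≠ 0 := fun h => hy (hw y h)
  generalize ternaryForm w y y = α at *
  have hSdet : S.det ≠ 0 := fun h0 => by
    have hdS := det_sq_mul_prod hS
    simp only [Matrix.cons_val, h0] at hdS
    exact mul_ne_zero (mul_ne_zero hα0 hβ) hγ (by linear_combination -hdS)
  let Sl := f.mapMatrix S
  let Sl' := f.mapMatrix S'
  have hmap {w w' : Fin 3 → k} {A : Matrix (Fin 3) (Fin 3) k}
      (hA : A.transpose * Matrix.diagonal w * A = Matrix.diagonal w') :
      (f.mapMatrix A).transpose * Matrix.diagonal (fun i => f (w i)) * f.mapMatrix A =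
        Matrix.diagonal fun i => f (w' i) := by
    have := congrArg f.mapMatrix hA
    rw [map_mul, map_mul] at this
    simpa [Matrix.diagonal_map, Function.comp_def, Matrix.transpose_map] using this
  have hSl := hmap hS
  have hSl' := hmap hS'
  have hSlu : IsUnit Sl.det := by
    rw [← RingHom.map_det]
    exact (map_ne_zero_iff f hf).mpr hSdet |>.isUnit
  obtain ⟨N, hN⟩ : ∃ N, Sl * N = M * Sl' :=
    ⟨Sl⁻¹ * (M * Sl'), Matrix.mul_nonsing_inv_cancel_left _ _ hSlu⟩
  have hN0 : (fun i => N i 0) = fun i => (1 : Matrix (Fin 3) (Fin 3) K) i 0 := by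
    refine Matrix.mulVec_injective_of_isUnit ((Matrix.isUnit_iff_isUnit_det _).mpr hSlu) ?_
    change (fun i => (Sl * N) i 0) = fun i => (Sl * (1 : Matrix (Fin 3) (Fin 3) K)) i 0
    rw [hN, mul_one]
    change M.mulVec (fun i => f (S' i 0)) = fun i => f (S i 0)
    simp only [hS0, hS0']
    exact hxy
  have hNG : N.transpose * Matrix.diagonal (fun i => f (![α, β, γ] i)) * N =
      Matrix.diagonal fun i => f (![α, β', γ'] i) := by
    rw [← hSl, ← hSl', ← hM]
    have : N.transpose * (Sl.transpose * Matrix.diagonal (fun i => f (w i)) * Sl) * N =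
        (Sl * N).transpose * Matrix.diagonal (fun i => f (w i)) * (Sl * N) := by
      simp only [Matrix.transpose_mul, mul_assoc]
    refine this.trans ?_
    rw [hN]
    simp only [Matrix.transpose_mul, mul_assoc]
    rfl
  have hN01 : N 0 1 = 0 := by
    have := congrFun (congrFun hNG 0) 1
    rw [Matrix.mul_apply, Fin.sum_univ_three] at this
    simp [Matrix.mul_diagonal, congrFun hN0 0, congrFun hN0 1, congrFun hN0 2] at this
    exact this.resolve_left hα0
  refine ⟨S, S', α, β, γ, β', γ', N 1 1, N 2 1, hα0, hβ, hγ, hβ', hγ', hS, hS', ?_⟩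
  have := congrFun (congrFun hNG 1) 1
  rw [Matrix.mul_apply, Fin.sum_univ_three] at this
  simp [Matrix.mul_diagonal, hN01] at this
  linear_combination -this

theorem nonempty_functionField_diagQF_algEquiv_of_im_det_eq_zero {k : Type*} [Field k]
    (h2 : (2 : k) ≠ 0) {a b c a' b' c' d : k} (ha : a ≠ 0) (hb : b ≠ 0) (hc : c ≠ 0) (ha' : a' ≠ 0)
    (hb' : b' ≠ 0) (hc' : c' ≠ 0) (hd : d = -(a * b * c)) [Fact (∀ r : k, r ^ 2 ≠ d + 0 * r)]
    (hw : TernaryAnisotropic fun i => algebraMap k (QuadraticAlgebra k d 0) (![a, b, c] i))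
    {M : Matrix (Fin 3) (Fin 3) (QuadraticAlgebra k d 0)}
    (hM : M.transpose * Matrix.diagonal
        (fun i => algebraMap k (QuadraticAlgebra k d 0) (![a, b, c] i)) * M =
      Matrix.diagonal fun i => algebraMap k (QuadraticAlgebra k d 0) (![a', b', c'] i))
    (hdet : M.det ≠ 0) (him : M.det.im = 0) :
    Nonempty (quadricFunctionField (diagQF a b c) ≃ₐ[k] quadricFunctionField (diagQF a' b' c')) := by
  have hf : Function.Injective (algebraMap k (QuadraticAlgebra k d 0)) :=
    (algebraMap k (QuadraticAlgebra k d 0)).injective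
  obtain ⟨m₀, hm₀⟩ : ∃ m₀, M.det = algebraMap k (QuadraticAlgebra k d 0) m₀ :=
    ⟨M.det.re, QuadraticAlgebra.ext (by simp) (by simpa using him)⟩
  have hm₀' : m₀ ^ 2 * (a * b * c) = a' * b' * c' := by
    have hprod := det_sq_mul_prod hM
    rw [hm₀, ← map_pow, ← map_mul, ← map_mul, ← map_mul, ← map_mul, ← map_mul] at hprod
    exact hf hprod
  obtain ⟨x, hx0, hx⟩ := Matrix.exists_mulVec_eq_zero_iff.mpr (det_map_im_eq_zero h2
    (w := ![a, b, c]) (by intro i; fin_cases i <;> assumption) hM hdet him)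
  have hxy : M.mulVec (fun i => algebraMap k (QuadraticAlgebra k d 0) (x i)) =
      fun i => algebraMap k _ ((M.map QuadraticAlgebra.re).mulVec x i) := by
    refine funext fun i => QuadraticAlgebra.ext ?_ ?_
    · simp [Matrix.mulVec, dotProduct, Fin.sum_univ_three]
    · have := congrFun hx i
      simp [Matrix.mulVec, dotProduct, Fin.sum_univ_three] at this
      simp [Matrix.mulVec, dotProduct, Fin.sum_univ_three, this]
  have hy0 : (M.map QuadraticAlgebra.re).mulVec x ≠ 0 := fun h0 => hx0 (by
    rw [h0] at hxy
    have := Matrix.eq_zero_of_mulVec_eq_zero hdet (hxy.trans (funext fun i => map_zero _))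
    exact funext fun i => hf ((congrFun this i).trans (map_zero _).symm))
  obtain ⟨S, S', α, β, γ, β', γ', U, W, hα, hβ, hγ, hβ', hγ', hS, hS', hUW⟩ :=
    hw.of_algebraMap.exists_orthogonal_bases (hw.of_mulVec hdet hM).of_algebraMap hM hy0 hxy
  have hdS := det_sq_mul_prod hS
  have hdS' := det_sq_mul_prod hS'
  simp only [Matrix.cons_val] at hdS hdS'
  have hSdet : S.det ≠ 0 := fun h0 => by
    rw [h0] at hdS
    exact mul_ne_zero (mul_ne_zero hα hβ) hγ (by linear_combination -hdS)
  have hm : β' * γ' = (S'.det * m₀ / S.det) ^ 2 * (β * γ) := by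
    rw [div_pow, div_mul_eq_mul_div, eq_div_iff (pow_ne_zero 2 hSdet)]
    refine mul_left_cancel₀ hα ?_
    linear_combination S.det ^ 2 * (-hdS' - S'.det ^ 2 * hm₀') + S'.det ^ 2 * m₀ ^ 2 * hdS
  obtain ⟨e₁⟩ := nonempty_functionField_diagQF_algEquiv_of_ternary h2 ha hb hc hα hβ hγ hS
  obtain ⟨e₂⟩ := nonempty_functionField_diagQF_algEquiv_of_ternary h2 ha' hb' hc' hα hβ' hγ' hS'
  obtain ⟨e₃⟩ := nonempty_functionField_diagQF_algEquiv_of_quadraticAlgebra h2 hα hβ hγ hβ' hγ'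
    (σ := S.det) (by linear_combination S.det ^ 2 * hd - hdS) hm hUW
  exact ⟨e₁.symm.trans (e₃.symm.trans e₂)⟩

/-! ### Function fields are determined by Brauer kernels -/

theorem quaternionAlgebra_splitsIn_iff {k : Type u} [Field k] {a b c a' b' c' : k}
    (h : ∀ (l : Type u) [Field l] [Algebra k l] [FiniteDimensional k l], Module.finrank k l ≤ 2 →
      ∀ (A : Type u) [Ring A] [Algebra l A] [Algebra.IsCentral l A] [IsSimpleRing A]
        [FiniteDimensional l A],
        (SplitsIn l A (quadricFunctionField (extendQF (diagQF a b c) l)) ↔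
          SplitsIn l A (quadricFunctionField (extendQF (diagQF a' b' c') l))))
    (l : Type u) [Field l] [Algebra k l] [FiniteDimensional k l] (hl : Module.finrank k l ≤ 2)
    (h2 : (2 : l) ≠ 0) {u v : l} (hu : u ≠ 0) (hv : v ≠ 0) :
    SplitsIn l ℍ[l,u,v] (quadricFunctionField
        (diagQF (algebraMap k l a) (algebraMap k l b) (algebraMap k l c))) ↔
      SplitsIn l ℍ[l,u,v] (quadricFunctionField
        (diagQF (algebraMap k l a') (algebraMap k l b') (algebraMap k l c'))) := by
  have := isCentral_quaternionAlgebra h2 hu (b := v)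
  have := isSimpleRing_quaternionAlgebra h2 hu hv
  have := h l hl ℍ[l,u,v]
  rwa [extendQF_diagQF, extendQF_diagQF] at this

theorem nonempty_functionField_diagQF_algEquiv_of_splitsIn_iff {k : Type u} [Field k]
    (h2 : (2 : k) ≠ 0) {a b c a' b' c' : k} (ha : a ≠ 0) (hb : b ≠ 0) (hc : c ≠ 0) (ha' : a' ≠ 0)
    (hb' : b' ≠ 0) (hc' : c' ≠ 0) (haniso : ∀ x, diagQF a b c x = 0 → x = 0)
    (h : ∀ (l : Type u) [Field l] [Algebra k l] [FiniteDimensional k l], Module.finrank k l ≤ 2 →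
      ∀ (A : Type u) [Ring A] [Algebra l A] [Algebra.IsCentral l A] [IsSimpleRing A]
        [FiniteDimensional l A],
        (SplitsIn l A (quadricFunctionField (extendQF (diagQF a b c) l)) ↔
          SplitsIn l A (quadricFunctionField (extendQF (diagQF a' b' c') l)))) :
    Nonempty (quadricFunctionField (diagQF a b c) ≃ₐ[k] quadricFunctionField (diagQF a' b' c')) := by
  by_cases hsq : ∃ δ, -(a * b * c) = δ ^ 2
  · obtain ⟨δ, hδ⟩ := hsq
    obtain ⟨M, hM⟩ := exists_isometry_of_splitsIn h2 ha hb hc ha' hb' hc' hδ haniso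
      (quaternionAlgebra_splitsIn_iff h k (by simp) h2 ha hb).mp
    obtain ⟨e⟩ := nonempty_functionField_diagQF_algEquiv_of_ternary h2 ha hb hc ha' hb' hc' hM
    exact ⟨e.symm⟩
  obtain ⟨d, hd⟩ : ∃ d, d = -(a * b * c) := ⟨_, rfl⟩
  have hanisol := diagQF_quadraticAlgebra_anisotropic h2 ha hb hc haniso
  rw [← hd] at hanisol hsq
  have : Fact (∀ r : k, r ^ 2 ≠ d + 0 * r) :=
    ⟨fun r hr => hsq ⟨r, by linear_combination -hr⟩⟩
  have hinj := (algebraMap k (QuadraticAlgebra k d 0)).injective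
  have hl2 : (2 : QuadraticAlgebra k d 0) ≠ 0 := two_ne_zero_of_algebra k h2
  have hne {s : k} (hs : s ≠ 0) : algebraMap k (QuadraticAlgebra k d 0) s ≠ 0 :=
    (map_ne_zero_iff _ hinj).mpr hs
  obtain ⟨M, hM⟩ := exists_isometry_of_splitsIn hl2 (hne ha) (hne hb) (hne hc) (hne ha') (hne hb')
    (hne hc') (δ := (⟨0, 1⟩ : QuadraticAlgebra k d 0)) (by
      rw [← map_mul, ← map_mul, ← map_neg, ← hd]
      refine QuadraticAlgebra.ext ?_ ?_ <;> simp [pow_two]) hanisol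
    (quaternionAlgebra_splitsIn_iff h (QuadraticAlgebra k d 0)
      (QuadraticAlgebra.finrank_eq_two d (0 : k)).le hl2 (hne ha) (hne hb)).mp
  have hprod := det_sq_mul_prod hM
  simp only [Matrix.cons_val] at hprod
  rw [← map_mul, ← map_mul, ← map_mul, ← map_mul] at hprod
  have hdet : M.det ≠ 0 := fun h0 => by
    rw [h0, zero_pow two_ne_zero, zero_mul] at hprod
    exact hne (mul_ne_zero (mul_ne_zero ha' hb') hc') hprod.symm
  by_cases him : M.det.im = 0
  · have hw := ternaryAnisotropic_of_diagQF hanisol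
    rw [map_cons_three (algebraMap k (QuadraticAlgebra k d 0))] at hM hw
    rw [map_cons_three (algebraMap k (QuadraticAlgebra k d 0)) a'] at hM
    exact nonempty_functionField_diagQF_algEquiv_of_im_det_eq_zero h2 ha hb hc ha' hb' hc' hd hw hM
      hdet him
  · exfalso
    have hre0 := congrArg QuadraticAlgebra.re hprod
    have him0 := congrArg QuadraticAlgebra.im hprod
    simp [pow_two] at hre0 him0
    have hm : M.det.re = 0 := by
      rcases him0 with h0 | h0
      · refine (mul_eq_zero.mp ((mul_eq_zero.mp ?_).resolve_left h2)).resolve_right him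
        linear_combination h0
      · tauto
    have hsq' : -(a' * b' * c') = (M.det.im * (a * b * c)) ^ 2 := by
      rw [hm] at hre0
      linear_combination hre0 - M.det.im ^ 2 * (a * b * c) * hd
    have haniso' (x) (hx : diagQF a' b' c' x = 0) : x = 0 := by
      have := diagQF_anisotropic_of_isometry hdet hM hanisol
        (fun i => algebraMap k (QuadraticAlgebra k d 0) (x i)) (by
          rw [diagQF_apply] at hx ⊢
          simpa using congrArg (algebraMap k (QuadraticAlgebra k d 0)) hx)
      exact funext fun i => hinj ((congrFun this i).trans (map_zero _).symm)
    obtain ⟨N, hN⟩ := exists_isometry_of_splitsIn h2 ha' hb' hc' ha hb hc hsq' haniso'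
      (quaternionAlgebra_splitsIn_iff h k (by simp) h2 ha' hb').mpr
    have hprod' := det_sq_mul_prod hN
    simp only [Matrix.cons_val] at hprod'
    refine hsq ⟨N.det * (M.det.im * (a * b * c)), ?_⟩
    linear_combination hd + N.det ^ 2 * hsq' + hprod'

theorem nonempty_functionField_algEquiv_of_splitsIn_iff {k : Type u} [Field k] (h2 : (2 : k) ≠ 0)
    {q q' : QuadraticForm k (Fin 4 → k)} (hq : NondegQF q) (hq' : NondegQF q')
    (h : ∀ (l : Type u) [Field l] [Algebra k l] [FiniteDimensional k l], Module.finrank k l ≤ 2 →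
      ∀ (A : Type u) [Ring A] [Algebra l A] [Algebra.IsCentral l A] [IsSimpleRing A]
        [FiniteDimensional l A],
        (SplitsIn l A (quadricFunctionField (extendQF q l)) ↔
          SplitsIn l A (quadricFunctionField (extendQF q' l)))) :
    Nonempty (quadricFunctionField q ≃ₐ[k] quadricFunctionField q') := by
  obtain ⟨a, b, c, ha, hb, hc, M, r, hM, hr, hMq⟩ := exists_diagQF_mulVec h2 hq
  obtain ⟨a', b', c', ha', hb', hc', M', r', hM', hr', hMq'⟩ := exists_diagQF_mulVec h2 hq'
  have hD := nondegQF_diagQF h2 ha hb hc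
  have hD' := nondegQF_diagQF h2 ha' hb' hc'
  have e := nonempty_functionField_algEquiv_of_mulVec h2 hq hD hM hr hMq
  have e' := nonempty_functionField_algEquiv_of_mulVec h2 hq' hD' hM' hr' hMq'
  have hdiag : ∀ (l : Type u) [Field l] [Algebra k l] [FiniteDimensional k l],
      Module.finrank k l ≤ 2 → ∀ (A : Type u) [Ring A] [Algebra l A] [Algebra.IsCentral l A]
        [IsSimpleRing A] [FiniteDimensional l A],
        (SplitsIn l A (quadricFunctionField (extendQF (diagQF a b c) l)) ↔
          SplitsIn l A (quadricFunctionField (extendQF (diagQF a' b' c') l))) := by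
    intro l _ _ _ hl A _ _ _ _ _
    rw [← splitsIn_congr (nonempty_functionField_extendQF_algEquiv e l), h l hl A,
      splitsIn_congr (nonempty_functionField_extendQF_algEquiv e' l)]
  obtain ⟨f⟩ : Nonempty (quadricFunctionField (diagQF a b c) ≃ₐ[k]
      quadricFunctionField (diagQF a' b' c')) := by
    by_cases hi : ∀ x, diagQF a b c x = 0 → x = 0
    · exact nonempty_functionField_diagQF_algEquiv_of_splitsIn_iff h2 ha hb hc ha' hb' hc' hi hdiag
    by_cases hi' : ∀ x, diagQF a' b' c' x = 0 → x = 0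
    · obtain ⟨f⟩ := nonempty_functionField_diagQF_algEquiv_of_splitsIn_iff h2 ha' hb' hc' ha hb hc
        hi' fun l _ _ _ hl A _ _ _ _ _ => (hdiag l hl A).symm
      exact ⟨f.symm⟩
    push Not at hi hi'
    exact nonempty_functionField_algEquiv_of_isotropic h2 hD hD'
      (hi.imp fun _ => And.symm) (hi'.imp fun _ => And.symm)
  exact ⟨e.some.trans (f.trans e'.some.symm)⟩

theorem stmt_12 (k : Type u) [Field k] (h2 : (2 : k) ≠ 0)
    (q q' : QuadraticForm k (Fin 4 → k)) (hq : NondegQF q) (hq' : NondegQF q') :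
    Nonempty (quadricFunctionField q ≃ₐ[k] quadricFunctionField q') ↔
      ∀ (l : Type u) [Field l] [Algebra k l] [FiniteDimensional k l],
        Module.finrank k l ≤ 2 →
        ∀ (A : Type u) [Ring A] [Algebra l A] [Algebra.IsCentral l A] [IsSimpleRing A]
          [FiniteDimensional l A],
          (SplitsIn l A (quadricFunctionField (extendQF q l)) ↔
            SplitsIn l A (quadricFunctionField (extendQF q' l))) := by
  refine ⟨fun e l _ _ _ _ A _ _ _ _ _ => ?_,
    nonempty_functionField_algEquiv_of_splitsIn_iff h2 hq hq'⟩
  exact splitsIn_congr (nonempty_functionField_extendQF_algEquiv e l)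

end
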